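/- arXiv:1602.02273 — 8 statements merged into one kernel-verified Lean document; each statement's English description precedes it below -/
import Mathlib

section
/- Let t₁, t₂, t₃ ∈ ℂ \ {0,1} be pairwise distinct and z₁, z₂, z₃ ∈ ℂ. Suppose A₀, A₁, B₁, B₂, B₃ are 2×2 complex matrices satisfying: trace(A₀) = −1/2, det(A₀) = 0, and A₀·(0,1)ᵀ = −(1/2)·(0,1)ᵀ; trace(A₁) = −1/2, det(A₁) = 0, and A₁·(1,1)ᵀ = −(1/2)·(1,1)ᵀ; for each i = 1,2,3, trace(Bᵢ) = 1/2, det(Bᵢ) = 0, and Bᵢ·(zᵢ,1)ᵀ = (1/2)·(zᵢ,1)ᵀ; and the matrix A_∞ := −(A₀ + A₁ + B₁ + B₂ + B₃) satisfies A_∞·(1,0)ᵀ = 0. Then there exist unique c₁, c₂, c₃ ∈ ℂ such that A₀ = [[0,0],[c₁(1−z₁)+c₂(1−z₂)+c₃(1−z₃), −1/2]], A₁ = [[s, −1/2−s],[s, −1/2−s]] where s = c₁z₁+c₂z₂+c₃z₃, and Bᵢ = [[−cᵢzᵢ, zᵢ/2 + cᵢzᵢ²],[−cᵢ, 1/2 +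 cᵢzᵢ]] for each i. -/
open Matrix

/-- A `2 × 2` matrix of trace `l` having `(z, 1)` as an eigenvector of eigenvalue `l` is determined
by its lower left entry. -/
theorem Matrix.eq_of_trace_eq_of_mulVec_eq {R : Type*} [CommRing R]
    {M : Matrix (Fin 2) (Fin 2) R} {l z : R} (htr : M.trace = l)
    (hvec : M.mulVec ![z, 1] = l • ![z, 1]) :
    M = !![M 1 0 * z, l * z - M 1 0 * z ^ 2; M 1 0, l - M 1 0 * z] := by
  have h₀ := congrFun hvec 0
  have h₁ := congrFun hvec 1
  simp [Matrix.mulVec, dotProduct, Fin.sum_univ_two] at h₀ h₁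
  rw [Matrix.trace_fin_two] at htr
  ext i j
  fin_cases i <;> fin_cases j <;> simp
  · linear_combination htr - h₁
  · linear_combination h₀ - z * (htr - h₁)
  · linear_combination h₁

/-- Normalization of the residue matrices of a fuchsian system on ℙ¹ with
poles 0, 1, t₁, t₂, t₃, ∞, spectral data {0,−1/2} over 0, 1, ∞ and {0,1/2}
over t₁, t₂, t₃, and normalized eigendirections: such a tuple of residue
matrices is of the form `∇₀ + c₁Θ₁ + c₂Θ₂ + c₃Θ₃` for a unique
`(c₁,c₂,c₃) ∈ ℂ³`. -/
theorem fuchsian_residues_normal_form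
    (t₁ t₂ t₃ : ℂ) (ht₁0 : t₁ ≠ 0) (ht₂0 : t₂ ≠ 0) (ht₃0 : t₃ ≠ 0)
    (ht₁1 : t₁ ≠ 1) (ht₂1 : t₂ ≠ 1) (ht₃1 : t₃ ≠ 1)
    (h₁₂ : t₁ ≠ t₂) (h₁₃ : t₁ ≠ t₃) (h₂₃ : t₂ ≠ t₃)
    (z₁ z₂ z₃ : ℂ)
    (A₀ A₁ B₁ B₂ B₃ : Matrix (Fin 2) (Fin 2) ℂ)
    (hA₀tr : A₀.trace = -(1/2)) (hA₀det : A₀.det = 0)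
    (hA₀vec : A₀.mulVec ![0, 1] = (-(1/2) : ℂ) • ![0, 1])
    (hA₁tr : A₁.trace = -(1/2)) (hA₁det : A₁.det = 0)
    (hA₁vec : A₁.mulVec ![1, 1] = (-(1/2) : ℂ) • ![1, 1])
    (hB₁tr : B₁.trace = 1/2) (hB₁det : B₁.det = 0)
    (hB₁vec : B₁.mulVec ![z₁, 1] = ((1/2 : ℂ)) • ![z₁, 1])
    (hB₂tr : B₂.trace = 1/2) (hB₂det : B₂.det = 0)
    (hB₂vec : B₂.mulVec ![z₂, 1] = ((1/2 : ℂ)) • ![z₂, 1])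
    (hB₃tr : B₃.trace = 1/2) (hB₃det : B₃.det = 0)
    (hB₃vec : B₃.mulVec ![z₃, 1] = ((1/2 : ℂ)) • ![z₃, 1])
    (hInf : (-(A₀ + A₁ + B₁ + B₂ + B₃)).mulVec ![1, 0] = 0) :
    ∃! c : ℂ × ℂ × ℂ,
      A₀ = !![0, 0;
              c.1 * (1 - z₁) + c.2.1 * (1 - z₂) + c.2.2 * (1 - z₃), -(1/2)] ∧
      A₁ = !![c.1 * z₁ + c.2.1 * z₂ + c.2.2 * z₃,
              -(1/2) - (c.1 * z₁ + c.2.1 * z₂ + c.2.2 * z₃);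
              c.1 * z₁ + c.2.1 * z₂ + c.2.2 * z₃,
              -(1/2) - (c.1 * z₁ + c.2.1 * z₂ + c.2.2 * z₃)] ∧
      B₁ = !![-(c.1 * z₁), z₁ / 2 + c.1 * z₁ ^ 2; -c.1, 1/2 + c.1 * z₁] ∧
      B₂ = !![-(c.2.1 * z₂), z₂ / 2 + c.2.1 * z₂ ^ 2; -c.2.1, 1/2 + c.2.1 * z₂] ∧
      B₃ = !![-(c.2.2 * z₃), z₃ / 2 + c.2.2 * z₃ ^ 2; -c.2.2, 1/2 + c.2.2 * z₃] := by
  have eA₀ := eq_of_trace_eq_of_mulVec_eq hA₀tr hA₀vec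
  have eA₁ := eq_of_trace_eq_of_mulVec_eq hA₁tr hA₁vec
  have eB₁ := eq_of_trace_eq_of_mulVec_eq hB₁tr hB₁vec
  have eB₂ := eq_of_trace_eq_of_mulVec_eq hB₂tr hB₂vec
  have eB₃ := eq_of_trace_eq_of_mulVec_eq hB₃tr hB₃vec
  generalize A₀ 1 0 = a₀ at eA₀
  generalize A₁ 1 0 = a₁ at eA₁
  generalize B₁ 1 0 = b₁ at eB₁
  generalize B₂ 1 0 = b₂ at eB₂
  generalize B₃ 1 0 = b₃ at eB₃
  have h₀ := congrFun hInf 0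
  have h₁ := congrFun hInf 1
  simp only [eA₀, eA₁, eB₁, eB₂, eB₃] at h₀ h₁
  simp [Matrix.mulVec, dotProduct, Fin.sum_univ_two] at h₀ h₁
  refine ⟨(-b₁, -b₂, -b₃), ⟨?_, ?_, ?_, ?_, ?_⟩, ?_⟩
  · rw [eA₀]
    ext i j
    fin_cases i <;> fin_cases j <;> simp
    linear_combination h₀ - h₁
  · rw [eA₁]
    ext i j
    fin_cases i <;> fin_cases j <;> simp <;> linear_combination -h₀
  · rw [eB₁]
    ext i j
    fin_cases i <;> fin_cases j <;> simp <;> ring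
  · rw [eB₂]
    ext i j
    fin_cases i <;> fin_cases j <;> simp <;> ring
  · rw [eB₃]
    ext i j
    fin_cases i <;> fin_cases j <;> simp <;> ring
  · rintro ⟨c₁, c₂, c₃⟩ ⟨-, -, h₁, h₂, h₃⟩
    have e₁ := congrFun₂ (eB₁.symm.trans h₁) 1 0
    have e₂ := congrFun₂ (eB₂.symm.trans h₂) 1 0
    have e₃ := congrFun₂ (eB₃.symm.trans h₃) 1 0
    simp at e₁ e₂ e₃
    simp [e₁, e₂, e₃]
end

section
/- Let z₁, z₂, z₃, c₁, c₂, c₃ ∈ ℂ with (c₁,c₂,c₃) ≠ (0,0,0). With R₀ = [[0,0],[Σᵢ cᵢ(1−zᵢ), −1/2]], R₁ = [[s, −1/2−s],[s, −1/2−s]] where s = Σᵢ cᵢzᵢ, and R_{tᵢ} = [[−cᵢzᵢ, zᵢ/2 + cᵢzᵢ²],[−cᵢ, 1/2 + cᵢzᵢ]], set R_∞ := −(R₀ + R₁ + R_{t₁} + R_{t₂} + R_{t₃}). Then: (a) R_∞·(1,0)ᵀ = 0 always; (b) the vector (1,0)ᵀ lies in the kernel of R₀ and in the kernel of R₁ if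 and only if c₁+c₂+c₃ = 0 and c₁z₁+c₂z₂+c₃z₃ = 0. In particular, if z₁ = z₂ = z₃, then the 0-eigendirections of R₀, R₁ and R_∞ all coincide if and only if c₁+c₂+c₃ = 0. -/
open Matrix

/-- A `2 × 2` complex matrix whose first column vanishes and whose lower right entry is nonzero
has kernel spanned by `(1, 0)ᵀ`. -/
lemma mulVec_eq_zero_iff_of_first_col_zero (w d : ℂ) (hd : d ≠ 0) (v : Fin 2 → ℂ) :
    !![0, w; 0, d].mulVec v = 0 ↔ v 1 = 0 := by
  constructor
  · intro h
    simpa [mulVec, dotProduct, Fin.sum_univ_two, hd] using congrFun h 1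
  · intro h
    ext i
    fin_cases i <;> simp [mulVec, dotProduct, Fin.sum_univ_two, h]

/-- (a) The residue at infinity `R_∞ = −(R₀+R₁+R_{t₁}+R_{t₂}+R_{t₃})` always
kills `(1,0)ᵀ`; (b) `(1,0)ᵀ` lies in the kernels of `R₀` and `R₁` iff
`c₁+c₂+c₃ = 0` and `c₁z₁+c₂z₂+c₃z₃ = 0`; in particular, if `z₁ = z₂ = z₃`,
the 0-eigendirections (kernels) of `R₀`, `R₁`, `R_∞` all coincide iff
`c₁+c₂+c₃ = 0`. -/
theorem zero_eigendirections_coincide_iff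
    (z₁ z₂ z₃ c₁ c₂ c₃ : ℂ) (hc : ¬(c₁ = 0 ∧ c₂ = 0 ∧ c₃ = 0))
    (R₀ R₁ Rt₁ Rt₂ Rt₃ Rinf : Matrix (Fin 2) (Fin 2) ℂ)
    (hR₀ : R₀ = !![0, 0; c₁ * (1 - z₁) + c₂ * (1 - z₂) + c₃ * (1 - z₃), -(1/2)])
    (hR₁ : R₁ = !![c₁ * z₁ + c₂ * z₂ + c₃ * z₃,
                   -(1/2) - (c₁ * z₁ + c₂ * z₂ + c₃ * z₃);
                   c₁ * z₁ + c₂ * z₂ + c₃ * z₃,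
                   -(1/2) - (c₁ * z₁ + c₂ * z₂ + c₃ * z₃)])
    (hRt₁ : Rt₁ = !![-(c₁ * z₁), z₁ / 2 + c₁ * z₁ ^ 2; -c₁, 1/2 + c₁ * z₁])
    (hRt₂ : Rt₂ = !![-(c₂ * z₂), z₂ / 2 + c₂ * z₂ ^ 2; -c₂, 1/2 + c₂ * z₂])
    (hRt₃ : Rt₃ = !![-(c₃ * z₃), z₃ / 2 + c₃ * z₃ ^ 2; -c₃, 1/2 + c₃ * z₃])
    (hRinf : Rinf = -(R₀ + R₁ + Rt₁ + Rt₂ + Rt₃)) :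
    Rinf.mulVec ![1, 0] = 0 ∧
    ((R₀.mulVec ![1, 0] = 0 ∧ R₁.mulVec ![1, 0] = 0) ↔
      (c₁ + c₂ + c₃ = 0 ∧ c₁ * z₁ + c₂ * z₂ + c₃ * z₃ = 0)) ∧
    (z₁ = z₂ → z₂ = z₃ →
      (((∀ v : Fin 2 → ℂ, R₀.mulVec v = 0 ↔ Rinf.mulVec v = 0) ∧
        (∀ v : Fin 2 → ℂ, R₁.mulVec v = 0 ↔ Rinf.mulVec v = 0)) ↔
        c₁ + c₂ + c₃ = 0)) := by
  have hinf : Rinf = !![0, 1/2 + (c₁ * z₁ + c₂ * z₂ + c₃ * z₃) - (z₁ / 2 + c₁ * z₁ ^ 2)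
      - (z₂ / 2 + c₂ * z₂ ^ 2) - (z₃ / 2 + c₃ * z₃ ^ 2); 0, -(1/2)] := by
    subst hR₀ hR₁ hRt₁ hRt₂ hRt₃ hRinf
    ext i j
    fin_cases i <;> fin_cases j <;> simp <;> ring
  have half_ne : (-(1/2) : ℂ) ≠ 0 := by norm_num
  have hker : ∀ v : Fin 2 → ℂ, Rinf.mulVec v = 0 ↔ v 1 = 0 := fun v ↦ by
    rw [hinf]
    exact mulVec_eq_zero_iff_of_first_col_zero _ _ half_ne v
  have hb : (R₀.mulVec ![1, 0] = 0 ∧ R₁.mulVec ![1, 0] = 0) ↔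
      (c₁ + c₂ + c₃ = 0 ∧ c₁ * z₁ + c₂ * z₂ + c₃ * z₃ = 0) := by
    have h₀ : R₀.mulVec ![1, 0] = 0 ↔
        c₁ * (1 - z₁) + c₂ * (1 - z₂) + c₃ * (1 - z₃) = 0 := by
      simp [hR₀, funext_iff, Fin.forall_fin_two]
    have h₁ : R₁.mulVec ![1, 0] = 0 ↔ c₁ * z₁ + c₂ * z₂ + c₃ * z₃ = 0 := by
      simp [hR₁, funext_iff, Fin.forall_fin_two]
    rw [h₀, h₁]
    constructor <;> rintro ⟨h, h'⟩ <;> refine ⟨?_, h'⟩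
    · linear_combination h + h'
    · linear_combination h - h'
  refine ⟨(hker _).2 (by simp), hb, ?_⟩
  rintro rfl rfl
  constructor
  · rintro ⟨h₀, h₁⟩
    exact (hb.1 ⟨(h₀ _).2 ((hker _).2 (by simp)), (h₁ _).2 ((hker _).2 (by simp))⟩).1
  · intro hsum
    have hs : c₁ * z₁ + c₂ * z₁ + c₃ * z₁ = 0 := by linear_combination z₁ * hsum
    have hs' : c₁ * (1 - z₁) + c₂ * (1 - z₁) + c₃ * (1 - z₁) = 0 := by
      linear_combination (1 - z₁) * hsum
    rw [hs'] at hR₀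
    rw [hs, sub_zero] at hR₁
    simp only [hker]
    rw [hR₀, hR₁]
    exact ⟨mulVec_eq_zero_iff_of_first_col_zero _ _ half_ne,
      mulVec_eq_zero_iff_of_first_col_zero _ _ half_ne⟩
end

section
/- Let t₁, t₂, t₃ ∈ ℂ be pairwise distinct, ν ∈ ℂ, and x_β, x_γ ∈ ℂ with 2x_β ≠ 1. Define z := x_β/(2x_β − 1) and, for each permutation {i,j,k} = {1,2,3}, cᵢ := 2ν·(tᵢ − x_γ)·(2x_β − 1)/((tᵢ − t_j)(tᵢ − t_k)). Then c₁ + c₂ + c₃ = 0, and the polynomials b(X) := ((2z−1)X − z)/2 and c(X) := −(t₁c₁+t₂c₂+t₃c₃)·X − (t₁t₂c₃ + t₂t₃c₁ + t₃t₁c₂) satisfy −b(X)·c(X) = ν·(X − x_β)·(X − x_γ) in ℂ[X]. -/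
open Polynomial

/-- The explicit preimage formula: for pairwise distinct `t₁,t₂,t₃`, `ν ∈ ℂ`
and `x_β, x_γ ∈ ℂ` with `2x_β ≠ 1`, setting `z = x_β/(2x_β−1)` and
`cᵢ = 2ν(tᵢ−x_γ)(2x_β−1)/((tᵢ−t_j)(tᵢ−t_k))`, one has `c₁+c₂+c₃ = 0` and
`−b·c = ν(X−x_β)(X−x_γ)` in `ℂ[X]`, where `b = ((2z−1)X−z)/2` and
`c = −(t₁c₁+t₂c₂+t₃c₃)X − (t₁t₂c₃+t₂t₃c₁+t₃t₁c₂)`. -/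
theorem explicit_preimage_formula
    (t₁ t₂ t₃ ν xβ xγ : ℂ)
    (h₁₂ : t₁ ≠ t₂) (h₁₃ : t₁ ≠ t₃) (h₂₃ : t₂ ≠ t₃)
    (hβ : 2 * xβ ≠ 1)
    (z c₁ c₂ c₃ : ℂ)
    (hz : z = xβ / (2 * xβ - 1))
    (hc₁ : c₁ = 2 * ν * (t₁ - xγ) * (2 * xβ - 1) / ((t₁ - t₂) * (t₁ - t₃)))
    (hc₂ : c₂ = 2 * ν * (t₂ - xγ) * (2 * xβ - 1) / ((t₂ - t₁) * (t₂ - t₃)))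
    (hc₃ : c₃ = 2 * ν * (t₃ - xγ) * (2 * xβ - 1) / ((t₃ - t₁) * (t₃ - t₂))) :
    c₁ + c₂ + c₃ = 0 ∧
    -(((1/2 : ℂ) • (C (2 * z - 1) * X - C z)) *
        (C (-(t₁ * c₁ + t₂ * c₂ + t₃ * c₃)) * X
          - C (t₁ * t₂ * c₃ + t₂ * t₃ * c₁ + t₃ * t₁ * c₂)))
      = C ν * ((X - C xβ) * (X - C xγ)) := by
  have hu : 2 * xβ - 1 ≠ 0 := sub_ne_zero.mpr hβ
  have d₁₂ : t₁ - t₂ ≠ 0 := sub_ne_zero.mpr h₁₂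
  have d₁₃ : t₁ - t₃ ≠ 0 := sub_ne_zero.mpr h₁₃
  have d₂₃ : t₂ - t₃ ≠ 0 := sub_ne_zero.mpr h₂₃
  rw [← neg_sub t₁ t₂] at hc₂
  rw [← neg_sub t₁ t₃, ← neg_sub t₂ t₃] at hc₃
  have hsum : c₁ + c₂ + c₃ = 0 := by
    rw [hc₁, hc₂, hc₃]
    field_simp
    ring
  have hlin : t₁ * c₁ + t₂ * c₂ + t₃ * c₃ = 2 * ν * (2 * xβ - 1) := by
    rw [hc₁, hc₂, hc₃]
    field_simp
    ring
  have hconst : t₁ * t₂ * c₃ + t₂ * t₃ * c₁ + t₃ * t₁ * c₂ = -(2 * ν * (2 * xβ - 1) * xγ) := by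
    rw [hc₁, hc₂, hc₃]
    field_simp
    ring
  have hlead : 2 * z - 1 = 1 / (2 * xβ - 1) := by
    rw [hz]
    field_simp
    ring
  refine ⟨hsum, Polynomial.funext fun x => ?_⟩
  rw [hlin, hconst, hlead, hz]
  simp only [eval_neg, eval_mul, eval_smul, eval_sub, eval_C, eval_X, smul_eq_mul]
  field_simp
  ring
end

section
/- Let t₁, t₂, t₃ ∈ ℂ \ {0,1} be pairwise distinct, (z,c) ∈ ℂ⁶, and let q₁, q₂, q₃ ∈ ℂ \ {0, 1, t₁, t₂, t₃} be pairwise distinct. Assume the polynomial identity Σᵢ cᵢ·((zᵢ−tᵢ)X − tᵢ(zᵢ−1))·Π_{j≠i}(X−t_j) = (Σᵢ cᵢ(zᵢ−tᵢ))·Π_{k=1}^3 (X−q_k) in ℂ[X], and define p_k := Σᵢ cᵢzᵢ·(1/(q_k−1) − 1/(q_k−tᵢ)) for k = 1,2,3. Set Λ := Σ_{{i,j,k}={1,2,3}} p_i·(q_i−t₁)(q_i−t₂)(q_i−t₃)/((q_i−q_j)(q_i−q_k)), and for ℓ = 1,2,3 let Λ_ℓ be the same expression with t_ℓ replaced by 1.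 Then for every permutation {i,j,k} = {1,2,3}: cᵢ = −((q₁−tᵢ)(q₂−tᵢ)(q₃−tᵢ)/(tᵢ(tᵢ−1)(tᵢ−t_j)(tᵢ−t_k)))·Λ and zᵢ·Λ = tᵢ·Λᵢ. -/
open Polynomial

/-- The residues of `(a x² + b x + c) / ((x - r) (x - q₁) (x - q₂) (x - q₃))` sum to zero. -/
theorem sum_residues_quadratic {K : Type*} [Field K] (a b c r : K) {q₁ q₂ q₃ : K}
    (h₁₂ : q₁ ≠ q₂) (h₁₃ : q₁ ≠ q₃) (h₂₃ : q₂ ≠ q₃)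
    (h₁ : q₁ ≠ r) (h₂ : q₂ ≠ r) (h₃ : q₃ ≠ r) :
    (a * q₁ ^ 2 + b * q₁ + c) / (q₁ - r) / ((q₁ - q₂) * (q₁ - q₃))
      + (a * q₂ ^ 2 + b * q₂ + c) / (q₂ - r) / ((q₂ - q₁) * (q₂ - q₃))
      + (a * q₃ ^ 2 + b * q₃ + c) / (q₃ - r) / ((q₃ - q₁) * (q₃ - q₂))
      = (a * r ^ 2 + b * r + c) / ((q₁ - r) * (q₂ - r) * (q₃ - r)) := by
  have e₁₂ := sub_ne_zero.2 h₁₂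
  have e₁₃ := sub_ne_zero.2 h₁₃
  have e₂₃ := sub_ne_zero.2 h₂₃
  have e₁ := sub_ne_zero.2 h₁
  have e₂ := sub_ne_zero.2 h₂
  have e₃ := sub_ne_zero.2 h₃
  rw [← neg_sub q₁ q₂, ← neg_sub q₁ q₃, ← neg_sub q₂ q₃]
  field_simp
  ring

/-- The sum of `fₖ / ∏ (qₖ - qⱼ)` over three nodes, when the values `fₖ * (qₖ - r)` are those of a
quadratic polynomial at the nodes `qₖ`. -/
theorem lagrange_sum_of_mul_sub_eq_quadratic {K : Type*} [Field K] (a b c r : K)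
    {q₁ q₂ q₃ f₁ f₂ f₃ : K}
    (h₁₂ : q₁ ≠ q₂) (h₁₃ : q₁ ≠ q₃) (h₂₃ : q₂ ≠ q₃)
    (h₁ : q₁ ≠ r) (h₂ : q₂ ≠ r) (h₃ : q₃ ≠ r)
    (hf₁ : f₁ * (q₁ - r) = a * q₁ ^ 2 + b * q₁ + c)
    (hf₂ : f₂ * (q₂ - r) = a * q₂ ^ 2 + b * q₂ + c)
    (hf₃ : f₃ * (q₃ - r) = a * q₃ ^ 2 + b * q₃ + c) :
    (f₁ / ((q₁ - q₂) * (q₁ - q₃)) + f₂ / ((q₂ - q₁) * (q₂ - q₃))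
      + f₃ / ((q₃ - q₁) * (q₃ - q₂))) * ((q₁ - r) * (q₂ - r) * (q₃ - r))
      = a * r ^ 2 + b * r + c := by
  have e₁ := sub_ne_zero.2 h₁
  have e₂ := sub_ne_zero.2 h₂
  have e₃ := sub_ne_zero.2 h₃
  rw [eq_div_of_mul_eq e₁ hf₁, eq_div_of_mul_eq e₂ hf₂, eq_div_of_mul_eq e₃ hf₃,
    sum_residues_quadratic a b c r h₁₂ h₁₃ h₂₃ h₁ h₂ h₃]
  field_simp

/-- Clearing denominators in `∑ wᵢ (1 / (q - 1) - 1 / (q - tᵢ))`. -/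
theorem sum_one_div_sub_mul_eq_quadratic {K : Type*} [Field K] (w₁ w₂ w₃ : K) {t₁ t₂ t₃ q : K}
    (h1 : q ≠ 1) (h₁ : q ≠ t₁) (h₂ : q ≠ t₂) (h₃ : q ≠ t₃) :
    (w₁ * (1 / (q - 1) - 1 / (q - t₁)) + w₂ * (1 / (q - 1) - 1 / (q - t₂))
      + w₃ * (1 / (q - 1) - 1 / (q - t₃))) * ((q - 1) * (q - t₁) * (q - t₂) * (q - t₃))
      = (w₁ * (1 - t₁) + w₂ * (1 - t₂) + w₃ * (1 - t₃)) * q ^ 2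
        + -(w₁ * (1 - t₁) * (t₂ + t₃) + w₂ * (1 - t₂) * (t₁ + t₃)
            + w₃ * (1 - t₃) * (t₁ + t₂)) * q
        + (w₁ * (1 - t₁) * (t₂ * t₃) + w₂ * (1 - t₂) * (t₁ * t₃)
            + w₃ * (1 - t₃) * (t₁ * t₂)) := by
  have e1 := sub_ne_zero.2 h1
  have e₁ := sub_ne_zero.2 h₁
  have e₂ := sub_ne_zero.2 h₂
  have e₃ := sub_ne_zero.2 h₃
  field_simp
  ring

/-- Inversion of the Darboux coordinate change (equation (17) of the paper):
if `q₁,q₂,q₃` are the zeros of the (2,1)-entry of the connection matrix and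
`p_k` are the corresponding eigenvalues, then `cᵢ` and `zᵢ` are recovered by
the stated rational expressions in `(q,p)`. -/
theorem darboux_inversion
    (t₁ t₂ t₃ : ℂ)
    (ht₁0 : t₁ ≠ 0) (ht₂0 : t₂ ≠ 0) (ht₃0 : t₃ ≠ 0)
    (ht₁1 : t₁ ≠ 1) (ht₂1 : t₂ ≠ 1) (ht₃1 : t₃ ≠ 1)
    (h₁₂ : t₁ ≠ t₂) (h₁₃ : t₁ ≠ t₃) (h₂₃ : t₂ ≠ t₃)
    (z₁ z₂ z₃ c₁ c₂ c₃ q₁ q₂ q₃ : ℂ)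
    (hq₁₂ : q₁ ≠ q₂) (hq₁₃ : q₁ ≠ q₃) (hq₂₃ : q₂ ≠ q₃)
    (hq₁0 : q₁ ≠ 0) (hq₁1 : q₁ ≠ 1) (hq₁t₁ : q₁ ≠ t₁) (hq₁t₂ : q₁ ≠ t₂) (hq₁t₃ : q₁ ≠ t₃)
    (hq₂0 : q₂ ≠ 0) (hq₂1 : q₂ ≠ 1) (hq₂t₁ : q₂ ≠ t₁) (hq₂t₂ : q₂ ≠ t₂) (hq₂t₃ : q₂ ≠ t₃)
    (hq₃0 : q₃ ≠ 0) (hq₃1 : q₃ ≠ 1) (hq₃t₁ : q₃ ≠ t₁) (hq₃t₂ : q₃ ≠ t₂) (hq₃t₃ : q₃ ≠ t₃)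
    (hpoly : C c₁ * (C (z₁ - t₁) * X - C (t₁ * (z₁ - 1))) * ((X - C t₂) * (X - C t₃))
           + C c₂ * (C (z₂ - t₂) * X - C (t₂ * (z₂ - 1))) * ((X - C t₁) * (X - C t₃))
           + C c₃ * (C (z₃ - t₃) * X - C (t₃ * (z₃ - 1))) * ((X - C t₁) * (X - C t₂))
         = C (c₁ * (z₁ - t₁) + c₂ * (z₂ - t₂) + c₃ * (z₃ - t₃))
             * ((X - C q₁) * (X - C q₂) * (X - C q₃)))
    (p₁ p₂ p₃ : ℂ)
    (hp₁ : p₁ = c₁ * z₁ * (1 / (q₁ - 1) - 1 / (q₁ - t₁))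
              + c₂ * z₂ * (1 / (q₁ - 1) - 1 / (q₁ - t₂))
              + c₃ * z₃ * (1 / (q₁ - 1) - 1 / (q₁ - t₃)))
    (hp₂ : p₂ = c₁ * z₁ * (1 / (q₂ - 1) - 1 / (q₂ - t₁))
              + c₂ * z₂ * (1 / (q₂ - 1) - 1 / (q₂ - t₂))
              + c₃ * z₃ * (1 / (q₂ - 1) - 1 / (q₂ - t₃)))
    (hp₃ : p₃ = c₁ * z₁ * (1 / (q₃ - 1) - 1 / (q₃ - t₁))
              + c₂ * z₂ * (1 / (q₃ - 1) - 1 / (q₃ - t₂))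
              + c₃ * z₃ * (1 / (q₃ - 1) - 1 / (q₃ - t₃)))
    (Λ Λ₁ Λ₂ Λ₃ : ℂ)
    (hΛ : Λ = p₁ * (q₁ - t₁) * (q₁ - t₂) * (q₁ - t₃) / ((q₁ - q₂) * (q₁ - q₃))
            + p₂ * (q₂ - t₁) * (q₂ - t₂) * (q₂ - t₃) / ((q₂ - q₁) * (q₂ - q₃))
            + p₃ * (q₃ - t₁) * (q₃ - t₂) * (q₃ - t₃) / ((q₃ - q₁) * (q₃ - q₂)))
    (hΛ₁ : Λ₁ = p₁ * (q₁ - 1) * (q₁ - t₂) * (q₁ - t₃) / ((q₁ - q₂) * (q₁ - q₃))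
              + p₂ * (q₂ - 1) * (q₂ - t₂) * (q₂ - t₃) / ((q₂ - q₁) * (q₂ - q₃))
              + p₃ * (q₃ - 1) * (q₃ - t₂) * (q₃ - t₃) / ((q₃ - q₁) * (q₃ - q₂)))
    (hΛ₂ : Λ₂ = p₁ * (q₁ - t₁) * (q₁ - 1) * (q₁ - t₃) / ((q₁ - q₂) * (q₁ - q₃))
              + p₂ * (q₂ - t₁) * (q₂ - 1) * (q₂ - t₃) / ((q₂ - q₁) * (q₂ - q₃))
              + p₃ * (q₃ - t₁) * (q₃ - 1) * (q₃ - t₃) / ((q₃ - q₁) * (q₃ - q₂)))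
    (hΛ₃ : Λ₃ = p₁ * (q₁ - t₁) * (q₁ - t₂) * (q₁ - 1) / ((q₁ - q₂) * (q₁ - q₃))
              + p₂ * (q₂ - t₁) * (q₂ - t₂) * (q₂ - 1) / ((q₂ - q₁) * (q₂ - q₃))
              + p₃ * (q₃ - t₁) * (q₃ - t₂) * (q₃ - 1) / ((q₃ - q₁) * (q₃ - q₂))) :
    c₁ = -((q₁ - t₁) * (q₂ - t₁) * (q₃ - t₁)
          / (t₁ * (t₁ - 1) * (t₁ - t₂) * (t₁ - t₃))) * Λ ∧
    c₂ = -((q₁ - t₂) * (q₂ - t₂) * (q₃ - t₂)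
          / (t₂ * (t₂ - 1) * (t₂ - t₁) * (t₂ - t₃))) * Λ ∧
    c₃ = -((q₁ - t₃) * (q₂ - t₃) * (q₃ - t₃)
          / (t₃ * (t₃ - 1) * (t₃ - t₁) * (t₃ - t₂))) * Λ ∧
    z₁ * Λ = t₁ * Λ₁ ∧ z₂ * Λ = t₂ * Λ₂ ∧ z₃ * Λ = t₃ * Λ₃ := by
  have hev (x : ℂ) := congrArg (eval x) hpoly
  simp only [eval_add, eval_sub, eval_mul, eval_C, eval_X] at hev
  set S := c₁ * (z₁ - t₁) + c₂ * (z₂ - t₂) + c₃ * (z₃ - t₃)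
  have g₁ := sum_one_div_sub_mul_eq_quadratic (c₁ * z₁) (c₂ * z₂) (c₃ * z₃) hq₁1 hq₁t₁ hq₁t₂ hq₁t₃
  have g₂ := sum_one_div_sub_mul_eq_quadratic (c₁ * z₁) (c₂ * z₂) (c₃ * z₃) hq₂1 hq₂t₁ hq₂t₂ hq₂t₃
  have g₃ := sum_one_div_sub_mul_eq_quadratic (c₁ * z₁) (c₂ * z₂) (c₃ * z₃) hq₃1 hq₃t₁ hq₃t₂ hq₃t₃
  rw [← hp₁] at g₁
  rw [← hp₂] at g₂
  rw [← hp₃] at g₃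
  have hΛS : Λ = -S := by
    have h := lagrange_sum_of_mul_sub_eq_quadratic _ _ _ 1 hq₁₂ hq₁₃ hq₂₃ hq₁1 hq₂1 hq₃1
      ((by ring : p₁ * (q₁ - t₁) * (q₁ - t₂) * (q₁ - t₃) * (q₁ - 1) = _).trans g₁)
      ((by ring : p₂ * (q₂ - t₁) * (q₂ - t₂) * (q₂ - t₃) * (q₂ - 1) = _).trans g₂)
      ((by ring : p₃ * (q₃ - t₁) * (q₃ - t₂) * (q₃ - t₃) * (q₃ - 1) = _).trans g₃)
    rw [← hΛ] at h
    have e : (q₁ - 1) * (q₂ - 1) * (q₃ - 1) ≠ 0 := by simp [sub_ne_zero, *]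
    apply mul_right_cancel₀ e
    linear_combination h + hev 1
  have hzΛ₁ : z₁ * Λ = t₁ * Λ₁ := by
    have h := lagrange_sum_of_mul_sub_eq_quadratic _ _ _ t₁ hq₁₂ hq₁₃ hq₂₃ hq₁t₁ hq₂t₁ hq₃t₁
      ((by ring : p₁ * (q₁ - 1) * (q₁ - t₂) * (q₁ - t₃) * (q₁ - t₁) = _).trans g₁)
      ((by ring : p₂ * (q₂ - 1) * (q₂ - t₂) * (q₂ - t₃) * (q₂ - t₁) = _).trans g₂)
      ((by ring : p₃ * (q₃ - 1) * (q₃ - t₂) * (q₃ - t₃) * (q₃ - t₁) = _).trans g₃)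
    rw [← hΛ₁] at h
    have e : (q₁ - t₁) * (q₂ - t₁) * (q₃ - t₁) ≠ 0 := by simp [sub_ne_zero, *]
    apply mul_right_cancel₀ e
    rw [hΛS]
    linear_combination -z₁ * hev t₁ - t₁ * h
  have hzΛ₂ : z₂ * Λ = t₂ * Λ₂ := by
    have h := lagrange_sum_of_mul_sub_eq_quadratic _ _ _ t₂ hq₁₂ hq₁₃ hq₂₃ hq₁t₂ hq₂t₂ hq₃t₂
      ((by ring : p₁ * (q₁ - t₁) * (q₁ - 1) * (q₁ - t₃) * (q₁ - t₂) = _).trans g₁)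
      ((by ring : p₂ * (q₂ - t₁) * (q₂ - 1) * (q₂ - t₃) * (q₂ - t₂) = _).trans g₂)
      ((by ring : p₃ * (q₃ - t₁) * (q₃ - 1) * (q₃ - t₃) * (q₃ - t₂) = _).trans g₃)
    rw [← hΛ₂] at h
    have e : (q₁ - t₂) * (q₂ - t₂) * (q₃ - t₂) ≠ 0 := by simp [sub_ne_zero, *]
    apply mul_right_cancel₀ e
    rw [hΛS]
    linear_combination -z₂ * hev t₂ - t₂ * h
  have hzΛ₃ : z₃ * Λ = t₃ * Λ₃ := by
    have h := lagrange_sum_of_mul_sub_eq_quadratic _ _ _ t₃ hq₁₂ hq₁₃ hq₂₃ hq₁t₃ hq₂t₃ hq₃t₃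
      ((by ring : p₁ * (q₁ - t₁) * (q₁ - t₂) * (q₁ - 1) * (q₁ - t₃) = _).trans g₁)
      ((by ring : p₂ * (q₂ - t₁) * (q₂ - t₂) * (q₂ - 1) * (q₂ - t₃) = _).trans g₂)
      ((by ring : p₃ * (q₃ - t₁) * (q₃ - t₂) * (q₃ - 1) * (q₃ - t₃) = _).trans g₃)
    rw [← hΛ₃] at h
    have e : (q₁ - t₃) * (q₂ - t₃) * (q₃ - t₃) ≠ 0 := by simp [sub_ne_zero, *]
    apply mul_right_cancel₀ e
    rw [hΛS]
    linear_combination -z₃ * hev t₃ - t₃ * h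
  refine ⟨?_, ?_, ?_, hzΛ₁, hzΛ₂, hzΛ₃⟩
  · have e : t₁ * (t₁ - 1) * (t₁ - t₂) * (t₁ - t₃) ≠ 0 :=
      mul_ne_zero (mul_ne_zero (mul_ne_zero ht₁0 (sub_ne_zero.2 ht₁1))
        (sub_ne_zero.2 h₁₂)) (sub_ne_zero.2 h₁₃)
    rw [hΛS, neg_mul_neg, div_mul_eq_mul_div, eq_div_iff e]
    linear_combination -hev t₁
  · have e : t₂ * (t₂ - 1) * (t₂ - t₁) * (t₂ - t₃) ≠ 0 :=
      mul_ne_zero (mul_ne_zero (mul_ne_zero ht₂0 (sub_ne_zero.2 ht₂1))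
        (sub_ne_zero.2 h₁₂.symm)) (sub_ne_zero.2 h₂₃)
    rw [hΛS, neg_mul_neg, div_mul_eq_mul_div, eq_div_iff e]
    linear_combination -hev t₂
  · have e : t₃ * (t₃ - 1) * (t₃ - t₁) * (t₃ - t₂) ≠ 0 :=
      mul_ne_zero (mul_ne_zero (mul_ne_zero ht₃0 (sub_ne_zero.2 ht₃1))
        (sub_ne_zero.2 h₁₃.symm)) (sub_ne_zero.2 h₂₃.symm)
    rw [hΛS, neg_mul_neg, div_mul_eq_mul_div, eq_div_iff e]
    linear_combination -hev t₃
end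

section
/- Let t₁, t₂, t₃ ∈ ℂ \ {0,1} be pairwise distinct. Let U ⊆ ℂ⁶ be the open set of tuples (q₁,q₂,q₃,p₁,p₂,p₃) with q₁, q₂, q₃ pairwise distinct and Λ ≠ 0, where Λ := Σ_{{i,j,k}={1,2,3}} p_i·(q_i−t₁)(q_i−t₂)(q_i−t₃)/((q_i−q_j)(q_i−q_k)), and let Λ_ℓ denote Λ with t_ℓ replaced by 1. Define Φ : U → ℂ⁶ by Φ(q,p) = (z₁,z₂,z₃,c₁,c₂,c₃) with zᵢ := tᵢ·Λᵢ/Λ and cᵢ := −((q₁−tᵢ)(q₂−tᵢ)(q₃−tᵢ)/(tᵢ(tᵢ−1)(tᵢ−t_j)(tᵢ−t_k)))·Λ for {i,j,k} = {1,2,3}. Then Φ is holomorphic on U and preserves the standard symplectic form: for every point P ∈ U and all vectors u, v ∈ ℂ⁶, ω(DΦ(P)u, DΦ(P)v) = ω(u,v), where ω((a,b),(a',b')) := Σ_{i=1}^3 (aᵢ·b'ᵢ − a'ᵢ·bᵢ) for a, a' the first three and b, b' the last three coordinates. -/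
open Function

/-- The quantity `Λ` of the Darboux coordinate change. -/
noncomputable def Lam (t q p : Fin 3 → ℂ) : ℂ :=
  p 0 * ((q 0 - t 0) * (q 0 - t 1) * (q 0 - t 2)) / ((q 0 - q 1) * (q 0 - q 2))
  + p 1 * ((q 1 - t 0) * (q 1 - t 1) * (q 1 - t 2)) / ((q 1 - q 0) * (q 1 - q 2))
  + p 2 * ((q 2 - t 0) * (q 2 - t 1) * (q 2 - t 2)) / ((q 2 - q 0) * (q 2 - q 1))

/-- The Darboux coordinate change `(q,p) ↦ (z,c)` given by formulas (17). -/
noncomputable def darbouxMap (t : Fin 3 → ℂ) (x : (Fin 3 → ℂ) × (Fin 3 → ℂ)) :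
    (Fin 3 → ℂ) × (Fin 3 → ℂ) :=
  (fun i => t i * Lam (Function.update t i 1) x.1 x.2 / Lam t x.1 x.2,
   fun i => -((x.1 0 - t i) * (x.1 1 - t i) * (x.1 2 - t i)
        / (t i * (t i - 1) * (t i - t (i + 1)) * (t i - t (i + 2))))
      * Lam t x.1 x.2)

section Symplectic

open Finset Polynomial Topology

variable {ι κ : Type*} [Fintype ι] [Fintype κ]

/-- If `∑ i, A i k • dQ i = dq k` near `q` for every `k`, then the functions
`N i = ∑ k, p k * A i k` satisfy `∑ i, dQ i ∧ dN i = ∑ k, dq k ∧ dp k`. -/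
theorem sum_wedge_eq_of_sum_smul_fderiv_eq_proj
    {Q : κ → (ι → ℂ) → ℂ} {A : κ → ι → (ι → ℂ) → ℂ} {q : ι → ℂ}
    (hQ : ∀ i, ContDiffAt ℂ 2 (Q i) q) (hA : ∀ i k, DifferentiableAt ℂ (A i k) q)
    (h : ∀ k, ∀ᶠ y in 𝓝 q,
      ∑ i, A i k y • fderiv ℂ (Q i) y = ContinuousLinearMap.proj (R := ℂ) k)
    (p a b a' b' : ι → ℂ) :
    ∑ i, (fderiv ℂ (Q i) q a * ∑ k, (b' k * A i k q + p k * fderiv ℂ (A i k) q a')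
        - fderiv ℂ (Q i) q a' * ∑ k, (b k * A i k q + p k * fderiv ℂ (A i k) q a))
      = ∑ k, (a k * b' k - a' k * b k) := by
  have hdual (k : ι) (w : ι → ℂ) : ∑ i, A i k q * fderiv ℂ (Q i) q w = w k := by
    simpa using congrArg (fun L => L w) (h k).self_of_nhds
  have hsymm (k : ι) : ∑ i, (fderiv ℂ (Q i) q a * fderiv ℂ (A i k) q a'
      - fderiv ℂ (Q i) q a' * fderiv ℂ (A i k) q a) = 0 := by
    have hQ' (i : κ) : DifferentiableAt ℂ (fderiv ℂ (Q i)) q :=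
      ((hQ i).fderiv_right (m := 1) (by norm_num)).differentiableAt (by norm_num)
    have hder : HasFDerivAt (fun y => ∑ i, A i k y • fderiv ℂ (Q i) y)
        (∑ i, (A i k q • fderiv ℂ (fderiv ℂ (Q i)) q
          + (fderiv ℂ (A i k) q).smulRight (fderiv ℂ (Q i) q))) q :=
      HasFDerivAt.fun_sum fun i _ => (hA i k).hasFDerivAt.smul (hQ' i).hasFDerivAt
    have hzero := hder.unique ((hasFDerivAt_const _ q).congr_of_eventuallyEq (h k))
    have h₁ := congrArg (fun L => L a a') hzero
    have h₂ := congrArg (fun L => L a' a) hzero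
    have hs (i : κ) : fderiv ℂ (fderiv ℂ (Q i)) q a a' = fderiv ℂ (fderiv ℂ (Q i)) q a' a :=
      ((hQ i).isSymmSndFDerivAt (by simp)).eq a a'
    simp only [_root_.sum_apply, add_apply, smul_apply, ContinuousLinearMap.smulRight_apply, smul_eq_mul,
      zero_apply, sum_add_distrib, hs] at h₁ h₂
    simp only [sum_sub_distrib, mul_comm (fderiv ℂ (Q _) q _)]
    linear_combination h₂ - h₁
  calc _ = ∑ k, (b' k * ∑ i, A i k q * fderiv ℂ (Q i) q a
          - b k * ∑ i, A i k q * fderiv ℂ (Q i) q a'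
          + p k * ∑ i, (fderiv ℂ (Q i) q a * fderiv ℂ (A i k) q a'
            - fderiv ℂ (Q i) q a' * fderiv ℂ (A i k) q a)) := by
        simp only [mul_sum, ← sum_sub_distrib, ← sum_add_distrib]
        rw [sum_comm]
        refine sum_congr rfl fun k _ => sum_congr rfl fun i _ => ?_
        ring
    _ = _ := by
        refine sum_congr rfl fun k _ => ?_
        rw [hdual, hdual, hsymm]
        ring

theorem eventually_injective {q : ι → ℂ} (hq : Function.Injective q) :
    ∀ᶠ y in 𝓝 q, Function.Injective y := by
  have : ∀ᶠ y in 𝓝 q, ∀ i j, i ≠ j → y i ≠ y j := by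
    simp only [Filter.eventually_all]
    intro i j hij
    have hsub : ContinuousAt (fun y : ι → ℂ => y i - y j) q := by fun_prop
    exact (hsub.eventually_ne (sub_ne_zero.2 (hq.ne hij))).mono fun y hy => sub_ne_zero.1 hy
  filter_upwards [this] with y hy i j hij
  exact by_contra fun hne => hy i j hne hij

variable [DecidableEq κ]

/-- The coordinate conjugate to the `i`-th homogeneous coordinate. -/
noncomputable def nodeDual (T : κ → ℂ) (i : κ) (q : ι → ℂ) : ℂ :=
  -(Lagrange.nodalWeight univ T i * ∏ k, (T i - q k))

theorem contDiff_nodeDual (T : κ → ℂ) (i : κ) :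
    ContDiff ℂ 2 (nodeDual (ι := ι) T i) := by
  unfold nodeDual
  exact (contDiff_const.mul (contDiff_prod fun k _ => by fun_prop)).neg

variable [DecidableEq ι]

/-- The coefficients of `p` in the homogeneous coordinates attached to the nodes `T`. -/
noncomputable def nodeCoeff (T : κ → ℂ) (i : κ) (k : ι) (q : ι → ℂ) : ℂ :=
  (∏ j ∈ univ.erase i, (q k - T j)) * ∏ l ∈ univ.erase k, (q k - q l)⁻¹

theorem sum_nodalWeight_mul_prod_mul_eval {T : κ → ℂ} (hT : Function.Injective T)
    {f : ℂ[X]} (hf : f.degree < Fintype.card κ) (x : ℂ) :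
    ∑ i, Lagrange.nodalWeight univ T i * (∏ j ∈ univ.erase i, (x - T j)) * f.eval (T i)
      = f.eval x := by
  conv_rhs => rw [Lagrange.eq_interpolate (s := univ) hT.injOn hf]
  simp only [Lagrange.interpolate_apply, eval_finsetSum, eval_mul, eval_C, Lagrange.basis,
    Lagrange.basisDivisor, eval_prod, eval_sub, eval_X, prod_mul_distrib, Lagrange.nodalWeight]
  exact sum_congr rfl fun i _ => mul_comm _ _

theorem sum_nodeCoeff_mul_nodeDual {T : κ → ℂ} (hT : Function.Injective T)
    (hcard : Fintype.card ι < Fintype.card κ) (k : ι) (q : ι → ℂ) :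
    ∑ i, nodeCoeff T i k q * nodeDual T i q = 0 := by
  have h := sum_nodalWeight_mul_prod_mul_eval hT (f := Lagrange.nodal univ q)
    (by rw [Lagrange.degree_nodal]; exact_mod_cast hcard) (q k)
  rw [Lagrange.eval_nodal_at_node (mem_univ k)] at h
  have h' := congrArg (fun y => -(∏ l ∈ univ.erase k, (q k - q l)⁻¹) * y) h
  simp only [mul_zero, mul_sum, Lagrange.eval_nodal] at h'
  rw [← h']
  refine sum_congr rfl fun i _ => ?_
  rw [nodeCoeff, nodeDual]
  ring

theorem differentiableAt_nodeCoeff (T : κ → ℂ) (i : κ) (k : ι) {q : ι → ℂ}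
    (hq : Function.Injective q) : DifferentiableAt ℂ (nodeCoeff T i k) q := by
  unfold nodeCoeff
  have hinv : ∀ l ∈ univ.erase k, DifferentiableAt ℂ (fun q : ι → ℂ => (q k - q l)⁻¹) q :=
    fun l hl => DifferentiableAt.fun_inv (by fun_prop)
      (sub_ne_zero.2 (hq.ne (ne_of_mem_erase hl).symm))
  have hnum : ∀ j ∈ univ.erase i, DifferentiableAt ℂ (fun q : ι → ℂ => q k - T j) q :=
    fun j _ => by fun_prop
  exact (HasFDerivAt.finsetProd fun j hj => (hnum j hj).hasFDerivAt).differentiableAt.fun_mul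
    (HasFDerivAt.finsetProd fun l hl => (hinv l hl).hasFDerivAt).differentiableAt

theorem fderiv_nodeDual (T : κ → ℂ) (i : κ) (q v : ι → ℂ) :
    fderiv ℂ (nodeDual T i) q v = ∑ m, Lagrange.nodalWeight univ T i
      * (Lagrange.nodal (univ.erase m) q).eval (T i) * v m := by
  have h : HasFDerivAt (nodeDual T i) (-(Lagrange.nodalWeight univ T i •
      ∑ m, (∏ l ∈ univ.erase m, (T i - q l)) • -ContinuousLinearMap.proj (R := ℂ) m)) q :=
    ((HasFDerivAt.finsetProd fun m _ =>
      ((ContinuousLinearMap.proj (R := ℂ) (φ := fun _ : ι => ℂ) m).hasFDerivAt (x := q)).const_sub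
        (T i)).const_mul _).neg
  rw [h.fderiv]
  simp [Lagrange.eval_nodal, mul_sum, mul_assoc]

theorem sum_nodeCoeff_smul_fderiv_nodeDual {T : κ → ℂ} (hT : Function.Injective T)
    (hcard : Fintype.card ι ≤ Fintype.card κ) {q : ι → ℂ} (hq : Function.Injective q) (k : ι) :
    ∑ i, nodeCoeff T i k q • fderiv ℂ (nodeDual T i) q = ContinuousLinearMap.proj (R := ℂ) k := by
  ext v
  have h (m : ι) := sum_nodalWeight_mul_prod_mul_eval hT (f := Lagrange.nodal (univ.erase m) q)
    (by
      rw [Lagrange.degree_nodal]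
      exact_mod_cast (card_erase_lt_of_mem (mem_univ m)).trans_le hcard) (q k)
  have hinv : (∏ l ∈ univ.erase k, (q k - q l)⁻¹) * ∏ l ∈ univ.erase k, (q k - q l) = 1 := by
    rw [← prod_mul_distrib]
    exact prod_eq_one fun l hl =>
      inv_mul_cancel₀ (sub_ne_zero.2 (hq.ne (ne_of_mem_erase hl).symm))
  calc _ = ∑ m, (∏ l ∈ univ.erase k, (q k - q l)⁻¹) * v m *
        (Lagrange.nodal (univ.erase m) q).eval (q k) := by
        simp only [_root_.sum_apply, smul_apply, smul_eq_mul,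
          fderiv_nodeDual, mul_sum, ← h]
        rw [sum_comm]
        refine sum_congr rfl fun m _ => sum_congr rfl fun i _ => ?_
        rw [nodeCoeff]
        ring
    _ = _ := by
        rw [sum_eq_single k, Lagrange.eval_nodal, ContinuousLinearMap.proj_apply]
        · linear_combination v k * hinv
        · intro m _ hm
          rw [Lagrange.eval_nodal_at_node (mem_erase.2 ⟨hm.symm, mem_univ k⟩), mul_zero]
        · simp

/-- The homogeneous coordinates, linear in `p`, attached to the nodes `T`. -/
noncomputable def nodeCoord (T : κ → ℂ) (i : κ) (x : (ι → ℂ) × (ι → ℂ)) : ℂ :=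
  ∑ k, x.2 k * nodeCoeff T i k x.1

theorem sum_nodeCoord_mul_nodeDual {T : κ → ℂ} (hT : Function.Injective T)
    (hcard : Fintype.card ι < Fintype.card κ) (x : (ι → ℂ) × (ι → ℂ)) :
    ∑ i, nodeCoord T i x * nodeDual T i x.1 = 0 := by
  simp only [nodeCoord, sum_mul, mul_assoc]
  rw [sum_comm]
  simp only [← mul_sum, sum_nodeCoeff_mul_nodeDual hT hcard, mul_zero, sum_const_zero]

theorem hasFDerivAt_nodeCoord (T : κ → ℂ) (i : κ) {x : (ι → ℂ) × (ι → ℂ)}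
    (hx : Function.Injective x.1) :
    ∃ L : ((ι → ℂ) × (ι → ℂ)) →L[ℂ] ℂ, HasFDerivAt (nodeCoord T i) L x ∧
      ∀ v, L v = ∑ k, (v.2 k * nodeCoeff T i k x.1
        + x.2 k * fderiv ℂ (nodeCoeff T i k) x.1 v.1) := by
  refine ⟨_, HasFDerivAt.fun_sum fun k _ => HasFDerivAt.mul
    ((ContinuousLinearMap.proj (R := ℂ) (φ := fun _ : ι => ℂ) k).hasFDerivAt.comp x
      (hasFDerivAt_snd (p := x)))
    ((differentiableAt_nodeCoeff T i k hx).hasFDerivAt.comp x (hasFDerivAt_fst (p := x))), ?_⟩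
  intro v
  simp only [_root_.sum_apply]
  refine sum_congr rfl fun k _ => ?_
  simp
  ring

theorem sum_fderiv_nodeDual_wedge_nodeCoord {T : κ → ℂ} (hT : Function.Injective T)
    (hcard : Fintype.card ι ≤ Fintype.card κ) {x : (ι → ℂ) × (ι → ℂ)}
    (hx : Function.Injective x.1) (u v : (ι → ℂ) × (ι → ℂ)) :
    ∑ i, (fderiv ℂ (nodeDual T i) x.1 u.1 * fderiv ℂ (nodeCoord T i) x v
        - fderiv ℂ (nodeDual T i) x.1 v.1 * fderiv ℂ (nodeCoord T i) x u)
      = ∑ k, (u.1 k * v.2 k - v.1 k * u.2 k) := by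
  have hN (i : κ) (w : (ι → ℂ) × (ι → ℂ)) : fderiv ℂ (nodeCoord T i) x w =
      ∑ k, (w.2 k * nodeCoeff T i k x.1 + x.2 k * fderiv ℂ (nodeCoeff T i k) x.1 w.1) := by
    obtain ⟨L, hL, hLv⟩ := hasFDerivAt_nodeCoord T i hx
    rw [hL.fderiv, hLv]
  simp only [hN]
  exact sum_wedge_eq_of_sum_smul_fderiv_eq_proj (fun i => (contDiff_nodeDual T i).contDiffAt)
    (fun i k => differentiableAt_nodeCoeff T i k hx)
    (fun k => (eventually_injective hx).mono fun y hy => sum_nodeCoeff_smul_fderiv_nodeDual hT hcard hy k) _ _ _ _ _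

end Symplectic

section Coordinates

theorem prod_univ_erase_eq {M : Type*} [CommMonoid M] (i : Fin 3) (f : Fin 3 → M) :
    ∏ j ∈ Finset.univ.erase i, f j = f (i + 1) * f (i + 2) := by
  have h : Finset.univ.erase i = {i + 1, i + 2} := by decide +revert
  have hne : i + 1 ≠ i + 2 := by decide +revert
  rw [h, Finset.prod_pair hne]

theorem prod_univ_erase_zero {M : Type*} [CommMonoid M] {n : ℕ} (f : Fin (n + 1) → M) :
    ∏ j ∈ Finset.univ.erase 0, f j = ∏ j : Fin n, f j.succ := by
  have h : Finset.univ.erase (0 : Fin (n + 1)) = Finset.univ.map (Fin.succEmb n) := by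
    ext j
    cases j using Fin.cases <;> simp
  simp [h]

theorem prod_univ_erase_succ {M : Type*} [CommMonoid M] {n : ℕ} (i : Fin n)
    (f : Fin (n + 1) → M) :
    ∏ j ∈ Finset.univ.erase i.succ, f j = f 0 * ∏ j ∈ Finset.univ.erase i, f j.succ := by
  have h : Finset.univ.erase i.succ
      = Finset.cons 0 ((Finset.univ.erase i).map (Fin.succEmb n)) (by simp) := by
    ext j
    cases j using Fin.cases <;> simp [(Fin.succ_ne_zero i).symm]
  rw [h, Finset.prod_cons, Finset.prod_map]
  rfl

theorem Lam_eq_sum (t q p : Fin 3 → ℂ) :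
    Lam t q p = ∑ k, p k * ((∏ j, (q k - t j)) * ∏ l ∈ Finset.univ.erase k, (q k - q l)⁻¹) := by
  have h : (1 : Fin 3) + 1 = 2 ∧ (1 : Fin 3) + 2 = 0 ∧ (2 : Fin 3) + 1 = 0 ∧ (2 : Fin 3) + 2 = 1 := by decide
  simp only [prod_univ_erase_eq, Fin.sum_univ_three, Fin.prod_univ_three, Lam, h, zero_add,
    div_eq_mul_inv, mul_inv]
  ring

theorem Lam_eq_nodeCoord (t : Fin 3 → ℂ) (x : (Fin 3 → ℂ) × (Fin 3 → ℂ)) :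
    Lam t x.1 x.2 = nodeCoord (Fin.cons 1 t : Fin 4 → ℂ) 0 x := by
  simp only [Lam_eq_sum, nodeCoord, nodeCoeff, prod_univ_erase_zero, Fin.cons_succ]

theorem Lam_update_eq_nodeCoord (t : Fin 3 → ℂ) (i : Fin 3) (x : (Fin 3 → ℂ) × (Fin 3 → ℂ)) :
    Lam (Function.update t i 1) x.1 x.2 = nodeCoord (Fin.cons 1 t : Fin 4 → ℂ) i.succ x := by
  simp only [Lam_eq_sum, nodeCoord, nodeCoeff, prod_univ_erase_succ, Fin.cons_succ, Fin.cons_zero]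
  refine Finset.sum_congr rfl fun k _ => ?_
  rw [← Finset.mul_prod_erase _ _ (Finset.mem_univ i), Function.update_self]
  congr 3
  refine Finset.prod_congr rfl fun j hj => ?_
  rw [Function.update_of_ne (Finset.ne_of_mem_erase hj)]

theorem darbouxMap_eq (t : Fin 3 → ℂ) :
    darbouxMap t = fun x => (fun i => t i * (nodeCoord (Fin.cons 1 t : Fin 4 → ℂ) i.succ x
        * (nodeCoord (Fin.cons 1 t : Fin 4 → ℂ) 0 x)⁻¹),
      fun i => -(t i)⁻¹ * (nodeDual (Fin.cons 1 t : Fin 4 → ℂ) i.succ x.1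
        * nodeCoord (Fin.cons 1 t : Fin 4 → ℂ) 0 x)) := by
  funext x
  refine Prod.ext (funext fun i => ?_) (funext fun i => ?_)
  · simp only [darbouxMap, Lam_update_eq_nodeCoord]
    rw [Lam_eq_nodeCoord]
    ring
  · simp only [darbouxMap, Lam_eq_nodeCoord, nodeDual, Lagrange.nodalWeight,
      prod_univ_erase_succ, prod_univ_erase_eq, Fin.cons_succ, Fin.cons_zero,
      Fin.prod_univ_three, div_eq_mul_inv, mul_inv]
    ring

end Coordinates

/-- Passing to the affine chart `N 0 ≠ 0` of the cone `∑ j, N j * Q j = 0`. -/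
theorem sum_affine_wedge_eq {n : ℕ} {s : Fin n → ℂ} (hs : ∀ i, s i ≠ 0)
    {N Q Nu Nv Qu Qv : Fin (n + 1) → ℂ} (h0 : N 0 ≠ 0)
    (hu : ∑ j, (N j * Qu j + Q j * Nu j) = 0) (hv : ∑ j, (N j * Qv j + Q j * Nv j) = 0) :
    ∑ i : Fin n,
      ((s i * (N i.succ * -(Nu 0 / N 0 ^ 2) + (N 0)⁻¹ * Nu i.succ))
          * (-(s i)⁻¹ * (Q i.succ * Nv 0 + N 0 * Qv i.succ))
        - (s i * (N i.succ * -(Nv 0 / N 0 ^ 2) + (N 0)⁻¹ * Nv i.succ))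
          * (-(s i)⁻¹ * (Q i.succ * Nu 0 + N 0 * Qu i.succ)))
      = ∑ j, (Qu j * Nv j - Qv j * Nu j) := by
  have hterm (i : Fin n) :
      ((s i * (N i.succ * -(Nu 0 / N 0 ^ 2) + (N 0)⁻¹ * Nu i.succ))
          * (-(s i)⁻¹ * (Q i.succ * Nv 0 + N 0 * Qv i.succ))
        - (s i * (N i.succ * -(Nv 0 / N 0 ^ 2) + (N 0)⁻¹ * Nv i.succ))
          * (-(s i)⁻¹ * (Q i.succ * Nu 0 + N 0 * Qu i.succ)))
      = (Qu i.succ * Nv i.succ - Qv i.succ * Nu i.succ)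
        + (Nu 0 / N 0 * (N i.succ * Qv i.succ + Q i.succ * Nv i.succ)
          - Nv 0 / N 0 * (N i.succ * Qu i.succ + Q i.succ * Nu i.succ)) := by
    have := hs i
    field_simp
    ring
  rw [Fin.sum_univ_succ] at hu hv
  simp only [hterm]
  rw [Finset.sum_add_distrib, Finset.sum_sub_distrib (f := fun i => Nu 0 / N 0 * _),
    ← Finset.mul_sum, ← Finset.mul_sum,
    eq_neg_of_add_eq_zero_right hu, eq_neg_of_add_eq_zero_right hv, Fin.sum_univ_succ]
  field_simp
  ring

/-- On the open set `U` where `q₁,q₂,q₃` are pairwise distinct and `Λ ≠ 0`,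
the Darboux coordinate change is holomorphic and preserves the standard
symplectic form `ω = Σᵢ dqᵢ ∧ dpᵢ = Σᵢ dzᵢ ∧ dcᵢ`. -/
theorem darbouxMap_symplectic
    (t : Fin 3 → ℂ) (ht0 : ∀ i, t i ≠ 0) (ht1 : ∀ i, t i ≠ 1)
    (htinj : Function.Injective t)
    (U : Set ((Fin 3 → ℂ) × (Fin 3 → ℂ)))
    (hU : U = {x | Function.Injective x.1 ∧ Lam t x.1 x.2 ≠ 0}) :
    IsOpen U ∧
    ∀ P ∈ U, DifferentiableAt ℂ (darbouxMap t) P ∧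
      ∀ u v : (Fin 3 → ℂ) × (Fin 3 → ℂ),
        (∑ i : Fin 3,
          ((fderiv ℂ (darbouxMap t) P u).1 i * (fderiv ℂ (darbouxMap t) P v).2 i
            - (fderiv ℂ (darbouxMap t) P v).1 i * (fderiv ℂ (darbouxMap t) P u).2 i))
        = ∑ i : Fin 3, (u.1 i * v.2 i - v.1 i * u.2 i) := by
  set T : Fin 4 → ℂ := Fin.cons 1 t with hTdef
  have hT : Function.Injective T :=
    Fin.cons_injective_iff.2 ⟨fun ⟨i, hi⟩ => ht1 i hi, htinj⟩
  have hcard : Fintype.card (Fin 3) < Fintype.card (Fin 4) := by simp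
  subst hU
  have hN (j : Fin 4) {x : (Fin 3 → ℂ) × (Fin 3 → ℂ)} (hx : Function.Injective x.1) :
      HasFDerivAt (nodeCoord T j) (fderiv ℂ (nodeCoord T j) x) x := by
    obtain ⟨L, hL, -⟩ := hasFDerivAt_nodeCoord T j hx
    exact hL.differentiableAt.hasFDerivAt
  refine ⟨isOpen_iff_mem_nhds.2 fun P ⟨hP, hP0⟩ => ?_, fun P ⟨hP, hP0⟩ => ?_⟩
  · simp only [Lam_eq_nodeCoord, ← hTdef] at hP0 ⊢
    exact (continuousAt_fst.eventually (eventually_injective hP)).and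
      ((hN 0 hP).continuousAt.eventually_ne hP0)
  rw [Lam_eq_nodeCoord, ← hTdef] at hP0
  have hQ (j : Fin 4) : HasFDerivAt (fun x : (Fin 3 → ℂ) × (Fin 3 → ℂ) => nodeDual T j x.1)
      ((fderiv ℂ (nodeDual T j) P.1).comp (ContinuousLinearMap.fst ℂ _ _)) P :=
    (((contDiff_nodeDual T j).differentiable (by norm_num)).differentiableAt.hasFDerivAt).comp P
      hasFDerivAt_fst
  have hinv : HasFDerivAt (fun x => (nodeCoord T 0 x)⁻¹)
      ((-(nodeCoord T 0 P ^ 2)⁻¹) • fderiv ℂ (nodeCoord T 0) P) P :=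
    (hasDerivAt_inv hP0).comp_hasFDerivAt P (hN 0 hP)
  have hder := ((hasFDerivAt_pi.2 fun i : Fin 3 =>
      ((hN i.succ hP).mul hinv).const_mul (t i)).prodMk
    (hasFDerivAt_pi.2 fun i : Fin 3 => ((hQ i.succ).mul (hN 0 hP)).const_mul
      (-(t i)⁻¹))).congr_of_eventuallyEq (.of_eq (darbouxMap_eq t))
  have hcone (w : (Fin 3 → ℂ) × (Fin 3 → ℂ)) :
      ∑ j, (nodeCoord T j P * fderiv ℂ (nodeDual T j) P.1 w.1
        + nodeDual T j P.1 * fderiv ℂ (nodeCoord T j) P w) = 0 := by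
    have h := HasFDerivAt.fun_sum (u := Finset.univ) fun j (_ : j ∈ Finset.univ) =>
      (hN j hP).fun_mul (hQ j)
    simp only [sum_nodeCoord_mul_nodeDual hT hcard] at h
    simpa using congrArg (fun L => L w) (h.unique (hasFDerivAt_const _ P))
  refine ⟨hder.differentiableAt, fun u v => ?_⟩
  rw [← sum_fderiv_nodeDual_wedge_nodeCoord hT hcard.le hP u v,
    ← sum_affine_wedge_eq ht0 hP0 (hcone u) (hcone v), hder.fderiv]
  refine Finset.sum_congr rfl fun i _ => ?_
  simp
  ring
end

section
/- Let t₁, t₂, t₃ ∈ ℂ \ {0,1} be pairwise distinct, and let z, c₁, c₂, c₃ ∈ ℂ. Set Q₀ := t₂t₃c₁ + t₁t₃c₂ + t₁t₂c₃, Q_∞ := t₁c₁ + t₂c₂ + t₃c₃, Q₁ := Q₀ + Q_∞, and assume Q₀·Q₁·Q_∞ ≠ 0. Define p₁ := z·Q₀/(t₁t₂t₃), p₂ := (z−1)·Q₁/((t₁−1)(t₂−1)(t₃−1)), and q₃ := −Q₀/Q_∞. Then t₁t₂t₃·(q₃−1)²·p₁ + (t₁−1)(t₂−1)(t₃−1)·q₃²·p₂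 = 0 if and only if Q₀·z + Q₁·(z−1) + Q_∞ = 0 (equivalently, z·Q_∞ = (1−2z)·Q₀). -/
/-- Substituting the inverse Darboux parametrization into the numerator of the
transversality determinant: it vanishes exactly on the reducibility locus
`Q₀z + Q₁(z−1) + Q_∞ = 0`, equivalently `zQ_∞ = (1−2z)Q₀`. -/
theorem determinant_vanishes_iff_reducible
    (t₁ t₂ t₃ z c₁ c₂ c₃ : ℂ)
    (ht₁0 : t₁ ≠ 0) (ht₂0 : t₂ ≠ 0) (ht₃0 : t₃ ≠ 0)
    (ht₁1 : t₁ ≠ 1) (ht₂1 : t₂ ≠ 1) (ht₃1 : t₃ ≠ 1)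
    (h₁₂ : t₁ ≠ t₂) (h₁₃ : t₁ ≠ t₃) (h₂₃ : t₂ ≠ t₃)
    (Q₀ Qinf Q₁ : ℂ)
    (hQ₀ : Q₀ = t₂ * t₃ * c₁ + t₁ * t₃ * c₂ + t₁ * t₂ * c₃)
    (hQinf : Qinf = t₁ * c₁ + t₂ * c₂ + t₃ * c₃)
    (hQ₁ : Q₁ = Q₀ + Qinf)
    (hne : Q₀ * Q₁ * Qinf ≠ 0)
    (p₁ p₂ q₃ : ℂ)
    (hp₁ : p₁ = z * Q₀ / (t₁ * t₂ * t₃))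
    (hp₂ : p₂ = (z - 1) * Q₁ / ((t₁ - 1) * (t₂ - 1) * (t₃ - 1)))
    (hq₃ : q₃ = -Q₀ / Qinf) :
    (t₁ * t₂ * t₃ * (q₃ - 1) ^ 2 * p₁
        + (t₁ - 1) * (t₂ - 1) * (t₃ - 1) * q₃ ^ 2 * p₂ = 0 ↔
      Q₀ * z + Q₁ * (z - 1) + Qinf = 0) ∧
    (Q₀ * z + Q₁ * (z - 1) + Qinf = 0 ↔ z * Qinf = (1 - 2 * z) * Q₀) := by
  have hQ₀ne : Q₀ ≠ 0 := left_ne_zero_of_mul (left_ne_zero_of_mul hne)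
  have hQ₁ne : Q₁ ≠ 0 := right_ne_zero_of_mul (left_ne_zero_of_mul hne)
  have hQinfne : Qinf ≠ 0 := right_ne_zero_of_mul hne
  have hp₁' : t₁ * t₂ * t₃ * p₁ = z * Q₀ := by
    rw [hp₁, mul_div_cancel₀ _ (mul_ne_zero (mul_ne_zero ht₁0 ht₂0) ht₃0)]
  have hp₂' : (t₁ - 1) * (t₂ - 1) * (t₃ - 1) * p₂ = (z - 1) * Q₁ := by
    rw [hp₂, mul_div_cancel₀ _ (mul_ne_zero (mul_ne_zero (sub_ne_zero.2 ht₁1)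
      (sub_ne_zero.2 ht₂1)) (sub_ne_zero.2 ht₃1))]
  have hfactor : t₁ * t₂ * t₃ * (q₃ - 1) ^ 2 * p₁
      + (t₁ - 1) * (t₂ - 1) * (t₃ - 1) * q₃ ^ 2 * p₂
      = Q₀ * Q₁ / Qinf ^ 2 * (Q₀ * z + Q₁ * (z - 1) + Qinf) := by
    calc
      _ = (q₃ - 1) ^ 2 * (z * Q₀) + q₃ ^ 2 * ((z - 1) * Q₁) := by
        rw [← hp₁', ← hp₂']
        ring
      _ = _ := by
        rw [hq₃, hQ₁]
        field_simp
        ring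
  refine ⟨?_, ?_⟩
  · rw [hfactor, mul_eq_zero_iff_left
      (div_ne_zero (mul_ne_zero hQ₀ne hQ₁ne) (pow_ne_zero 2 hQinfne))]
  · rw [← sub_eq_zero (a := z * Qinf), hQ₁]
    ring_nf
end

section
/- Let t₁, t₂, t₃ ∈ ℂ \ {0,1} be pairwise distinct. For (p₁,p₂,q₃) ∈ ℂ³ set D := t₁t₂t₃(q₃−1)p₁ − (t₁−1)(t₂−1)(t₃−1)q₃p₂ and Q^Darb := q₃(q₃−1)·D, and define the map Ψ_Σ(p₁,p₂,q₃) := (z, c₁, c₂, c₃) by z := t₁t₂t₃(q₃−1)p₁/D and cᵢ := D·(q₃−tᵢ)/(q₃(q₃−1)(tᵢ−t_j)(tᵢ−t_k)) for {i,j,k} = {1,2,3}. For (z,c₁,c₂,c₃) ∈ ℂ⁴ set Q₀ := t₂t₃c₁+t₁t₃c₂+t₁t₂c₃, Q_∞ := t₁c₁+t₂c₂+t₃c₃, Q₁ := Q₀+Q_∞. Then: (a) Ψ_Σ is well defined on the set {(p₁,p₂,q₃) : Q^Darb ≠ 0} and takes values in {(z,c) : c₁+c₂+c₃ = 0 and Q₀Q₁Q_∞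 ≠ 0}; (b) the corestricted map is a bijection, with inverse given by p₁ = z·Q₀/(t₁t₂t₃), p₂ = (z−1)·Q₁/((t₁−1)(t₂−1)(t₃−1)), q₃ = −Q₀/Q_∞; (c) it maps {(p₁,p₂,q₃) : Q^Darb ≠ 0 and t₁t₂t₃(q₃−1)²p₁ + (t₁−1)(t₂−1)(t₃−1)q₃²p₂ = 0} onto {(z,c) : c₁+c₂+c₃ = 0, Q₀Q₁Q_∞ ≠ 0, and Q₀z + Q₁(z−1) + Q_∞ = 0}. -/
/-- `D = t₁t₂t₃(q₃−1)p₁ − (t₁−1)(t₂−1)(t₃−1)q₃p₂`, for `x = (p₁,p₂,q₃)`. -/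
noncomputable def Dqp (t₁ t₂ t₃ : ℂ) (x : ℂ × ℂ × ℂ) : ℂ :=
  t₁ * t₂ * t₃ * (x.2.2 - 1) * x.1 - (t₁ - 1) * (t₂ - 1) * (t₃ - 1) * x.2.2 * x.2.1

/-- The map `Ψ_Σ : (p₁,p₂,q₃) ↦ (z,c₁,c₂,c₃)` of Lemma 4.1. -/
noncomputable def PsiSigma (t₁ t₂ t₃ : ℂ) (x : ℂ × ℂ × ℂ) : ℂ × ℂ × ℂ × ℂ :=
  (t₁ * t₂ * t₃ * (x.2.2 - 1) * x.1 / Dqp t₁ t₂ t₃ x,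
   Dqp t₁ t₂ t₃ x * (x.2.2 - t₁) / (x.2.2 * (x.2.2 - 1) * (t₁ - t₂) * (t₁ - t₃)),
   Dqp t₁ t₂ t₃ x * (x.2.2 - t₂) / (x.2.2 * (x.2.2 - 1) * (t₂ - t₁) * (t₂ - t₃)),
   Dqp t₁ t₂ t₃ x * (x.2.2 - t₃) / (x.2.2 * (x.2.2 - 1) * (t₃ - t₁) * (t₃ - t₂)))

/-- `Q₀ = t₂t₃c₁ + t₁t₃c₂ + t₁t₂c₃`, for `y = (z,c₁,c₂,c₃)`. -/
noncomputable def Qzero (t₁ t₂ t₃ : ℂ) (y : ℂ × ℂ × ℂ × ℂ) : ℂ :=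
  t₂ * t₃ * y.2.1 + t₁ * t₃ * y.2.2.1 + t₁ * t₂ * y.2.2.2

/-- `Q_∞ = t₁c₁ + t₂c₂ + t₃c₃`, for `y = (z,c₁,c₂,c₃)`. -/
noncomputable def Qinfty (t₁ t₂ t₃ : ℂ) (y : ℂ × ℂ × ℂ × ℂ) : ℂ :=
  t₁ * y.2.1 + t₂ * y.2.2.1 + t₃ * y.2.2.2

/-- The explicit inverse `(z,c) ↦ (p₁,p₂,q₃)` of `Ψ_Σ`. -/
noncomputable def PsiSigmaInv (t₁ t₂ t₃ : ℂ) (y : ℂ × ℂ × ℂ × ℂ) : ℂ × ℂ × ℂ :=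
  (y.1 * Qzero t₁ t₂ t₃ y / (t₁ * t₂ * t₃),
   (y.1 - 1) * (Qzero t₁ t₂ t₃ y + Qinfty t₁ t₂ t₃ y)
      / ((t₁ - 1) * (t₂ - 1) * (t₃ - 1)),
   -Qzero t₁ t₂ t₃ y / Qinfty t₁ t₂ t₃ y)

theorem sum_PsiSigma_eq_zero {t₁ t₂ t₃ : ℂ} (h₁₂ : t₁ ≠ t₂) (h₁₃ : t₁ ≠ t₃) (h₂₃ : t₂ ≠ t₃)
    {x : ℂ × ℂ × ℂ} (hq : x.2.2 ≠ 0) (hq' : x.2.2 - 1 ≠ 0) :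
    (PsiSigma t₁ t₂ t₃ x).2.1 + (PsiSigma t₁ t₂ t₃ x).2.2.1 + (PsiSigma t₁ t₂ t₃ x).2.2.2 = 0 := by
  simp only [PsiSigma]
  generalize Dqp t₁ t₂ t₃ x = D
  rw [← neg_sub t₁ t₂, ← neg_sub t₁ t₃, ← neg_sub t₂ t₃]
  have := sub_ne_zero.2 h₁₂
  have := sub_ne_zero.2 h₁₃
  have := sub_ne_zero.2 h₂₃
  field_simp
  ring

theorem Qzero_PsiSigma {t₁ t₂ t₃ : ℂ} (h₁₂ : t₁ ≠ t₂) (h₁₃ : t₁ ≠ t₃) (h₂₃ : t₂ ≠ t₃)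
    {x : ℂ × ℂ × ℂ} (hq : x.2.2 ≠ 0) (hq' : x.2.2 - 1 ≠ 0) :
    Qzero t₁ t₂ t₃ (PsiSigma t₁ t₂ t₃ x) = Dqp t₁ t₂ t₃ x / (x.2.2 - 1) := by
  simp only [PsiSigma, Qzero]
  generalize Dqp t₁ t₂ t₃ x = D
  rw [← neg_sub t₁ t₂, ← neg_sub t₁ t₃, ← neg_sub t₂ t₃]
  have := sub_ne_zero.2 h₁₂
  have := sub_ne_zero.2 h₁₃
  have := sub_ne_zero.2 h₂₃
  field_simp
  ring

theorem Qinfty_PsiSigma {t₁ t₂ t₃ : ℂ} (h₁₂ : t₁ ≠ t₂) (h₁₃ : t₁ ≠ t₃) (h₂₃ : t₂ ≠ t₃)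
    {x : ℂ × ℂ × ℂ} (hq : x.2.2 ≠ 0) (hq' : x.2.2 - 1 ≠ 0) :
    Qinfty t₁ t₂ t₃ (PsiSigma t₁ t₂ t₃ x) = -(Dqp t₁ t₂ t₃ x / (x.2.2 * (x.2.2 - 1))) := by
  simp only [PsiSigma, Qinfty]
  generalize Dqp t₁ t₂ t₃ x = D
  rw [← neg_sub t₁ t₂, ← neg_sub t₁ t₃, ← neg_sub t₂ t₃]
  have := sub_ne_zero.2 h₁₂
  have := sub_ne_zero.2 h₁₃
  have := sub_ne_zero.2 h₂₃
  field_simp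
  ring

theorem Qzero_add_Qinfty_PsiSigma {t₁ t₂ t₃ : ℂ} (h₁₂ : t₁ ≠ t₂) (h₁₃ : t₁ ≠ t₃) (h₂₃ : t₂ ≠ t₃)
    {x : ℂ × ℂ × ℂ} (hq : x.2.2 ≠ 0) (hq' : x.2.2 - 1 ≠ 0) :
    Qzero t₁ t₂ t₃ (PsiSigma t₁ t₂ t₃ x) + Qinfty t₁ t₂ t₃ (PsiSigma t₁ t₂ t₃ x) =
      Dqp t₁ t₂ t₃ x / x.2.2 := by
  rw [Qzero_PsiSigma h₁₂ h₁₃ h₂₃ hq hq', Qinfty_PsiSigma h₁₂ h₁₃ h₂₃ hq hq']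
  field_simp
  ring

theorem PsiSigma_fst_sub_one {t₁ t₂ t₃ : ℂ} {x : ℂ × ℂ × ℂ} (hD : Dqp t₁ t₂ t₃ x ≠ 0) :
    (PsiSigma t₁ t₂ t₃ x).1 - 1 =
      (t₁ - 1) * (t₂ - 1) * (t₃ - 1) * x.2.2 * x.2.1 / Dqp t₁ t₂ t₃ x := by
  rw [PsiSigma, div_sub_one hD]
  congr 1
  rw [Dqp]
  ring

theorem PsiSigmaInv_PsiSigma {t₁ t₂ t₃ : ℂ} (ht₁0 : t₁ ≠ 0) (ht₂0 : t₂ ≠ 0) (ht₃0 : t₃ ≠ 0)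
    (ht₁1 : t₁ ≠ 1) (ht₂1 : t₂ ≠ 1) (ht₃1 : t₃ ≠ 1)
    (h₁₂ : t₁ ≠ t₂) (h₁₃ : t₁ ≠ t₃) (h₂₃ : t₂ ≠ t₃)
    {x : ℂ × ℂ × ℂ} (hq : x.2.2 ≠ 0) (hq' : x.2.2 - 1 ≠ 0) (hD : Dqp t₁ t₂ t₃ x ≠ 0) :
    PsiSigmaInv t₁ t₂ t₃ (PsiSigma t₁ t₂ t₃ x) = x := by
  have := sub_ne_zero.2 ht₁1
  have := sub_ne_zero.2 ht₂1
  have := sub_ne_zero.2 ht₃1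
  rw [PsiSigmaInv, Qzero_add_Qinfty_PsiSigma h₁₂ h₁₃ h₂₃ hq hq', PsiSigma_fst_sub_one hD,
    Qzero_PsiSigma h₁₂ h₁₃ h₂₃ hq hq', Qinfty_PsiSigma h₁₂ h₁₃ h₂₃ hq hq']
  refine Prod.ext ?_ (Prod.ext ?_ ?_)
  · simp only [PsiSigma]
    field_simp
  · field_simp
  · field_simp

theorem PsiSigmaInv_snd_snd_sub_one {t₁ t₂ t₃ : ℂ} {y : ℂ × ℂ × ℂ × ℂ}
    (hi : Qinfty t₁ t₂ t₃ y ≠ 0) :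
    (PsiSigmaInv t₁ t₂ t₃ y).2.2 - 1 =
      -(Qzero t₁ t₂ t₃ y + Qinfty t₁ t₂ t₃ y) / Qinfty t₁ t₂ t₃ y := by
  simp only [PsiSigmaInv]
  field_simp
  ring

theorem Dqp_PsiSigmaInv {t₁ t₂ t₃ : ℂ} (ht₁0 : t₁ ≠ 0) (ht₂0 : t₂ ≠ 0) (ht₃0 : t₃ ≠ 0)
    (ht₁1 : t₁ ≠ 1) (ht₂1 : t₂ ≠ 1) (ht₃1 : t₃ ≠ 1)
    {y : ℂ × ℂ × ℂ × ℂ} (hi : Qinfty t₁ t₂ t₃ y ≠ 0) :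
    Dqp t₁ t₂ t₃ (PsiSigmaInv t₁ t₂ t₃ y) =
      -(Qzero t₁ t₂ t₃ y * (Qzero t₁ t₂ t₃ y + Qinfty t₁ t₂ t₃ y)) / Qinfty t₁ t₂ t₃ y := by
  have := sub_ne_zero.2 ht₁1
  have := sub_ne_zero.2 ht₂1
  have := sub_ne_zero.2 ht₃1
  rw [Dqp, PsiSigmaInv_snd_snd_sub_one hi]
  simp only [PsiSigmaInv]
  field_simp
  ring

theorem PsiSigma_PsiSigmaInv {t₁ t₂ t₃ : ℂ} (ht₁0 : t₁ ≠ 0) (ht₂0 : t₂ ≠ 0) (ht₃0 : t₃ ≠ 0)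
    (ht₁1 : t₁ ≠ 1) (ht₂1 : t₂ ≠ 1) (ht₃1 : t₃ ≠ 1)
    (h₁₂ : t₁ ≠ t₂) (h₁₃ : t₁ ≠ t₃) (h₂₃ : t₂ ≠ t₃) {y : ℂ × ℂ × ℂ × ℂ}
    (hc : y.2.1 + y.2.2.1 + y.2.2.2 = 0) (h0 : Qzero t₁ t₂ t₃ y ≠ 0)
    (h1 : Qzero t₁ t₂ t₃ y + Qinfty t₁ t₂ t₃ y ≠ 0) (hi : Qinfty t₁ t₂ t₃ y ≠ 0) :
    PsiSigma t₁ t₂ t₃ (PsiSigmaInv t₁ t₂ t₃ y) = y := by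
  have h12 := sub_ne_zero.2 h₁₂
  have h13 := sub_ne_zero.2 h₁₃
  have h23 := sub_ne_zero.2 h₂₃
  have h21 := sub_ne_zero.2 h₁₂.symm
  have h31 := sub_ne_zero.2 h₁₃.symm
  have h32 := sub_ne_zero.2 h₂₃.symm
  have key (s : ℂ) {u v : ℂ} (hu : u ≠ 0) (hv : v ≠ 0) :
      -(Qzero t₁ t₂ t₃ y * (Qzero t₁ t₂ t₃ y + Qinfty t₁ t₂ t₃ y)) / Qinfty t₁ t₂ t₃ y
        * (-Qzero t₁ t₂ t₃ y / Qinfty t₁ t₂ t₃ y - s)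
        / (-Qzero t₁ t₂ t₃ y / Qinfty t₁ t₂ t₃ y
          * (-(Qzero t₁ t₂ t₃ y + Qinfty t₁ t₂ t₃ y) / Qinfty t₁ t₂ t₃ y) * u * v) =
      (Qzero t₁ t₂ t₃ y + s * Qinfty t₁ t₂ t₃ y) / (u * v) := by
    field_simp
    ring
  have hsnd : (PsiSigmaInv t₁ t₂ t₃ y).2.2 = -Qzero t₁ t₂ t₃ y / Qinfty t₁ t₂ t₃ y := rfl
  rw [PsiSigma, PsiSigmaInv_snd_snd_sub_one hi, Dqp_PsiSigmaInv ht₁0 ht₂0 ht₃0 ht₁1 ht₂1 ht₃1 hi,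
    hsnd, key t₁ h12 h13, key t₂ h21 h23, key t₃ h31 h32]
  refine Prod.ext ?_ (Prod.ext ?_ (Prod.ext ?_ ?_))
  · simp only [PsiSigmaInv]
    field_simp
  · rw [div_eq_iff (mul_ne_zero h12 h13), Qzero, Qinfty]
    linear_combination (t₁ * t₂ + t₁ * t₃) * hc
  · rw [div_eq_iff (mul_ne_zero h21 h23), Qzero, Qinfty]
    linear_combination (t₁ * t₂ + t₂ * t₃) * hc
  · rw [div_eq_iff (mul_ne_zero h31 h32), Qzero, Qinfty]
    linear_combination (t₁ * t₃ + t₂ * t₃) * hc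

theorem PsiSigma_reducible_iff {t₁ t₂ t₃ : ℂ} (h₁₂ : t₁ ≠ t₂) (h₁₃ : t₁ ≠ t₃) (h₂₃ : t₂ ≠ t₃)
    {x : ℂ × ℂ × ℂ} (hq : x.2.2 ≠ 0) (hq' : x.2.2 - 1 ≠ 0) (hD : Dqp t₁ t₂ t₃ x ≠ 0) :
    Qzero t₁ t₂ t₃ (PsiSigma t₁ t₂ t₃ x) * (PsiSigma t₁ t₂ t₃ x).1
        + (Qzero t₁ t₂ t₃ (PsiSigma t₁ t₂ t₃ x) + Qinfty t₁ t₂ t₃ (PsiSigma t₁ t₂ t₃ x))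
          * ((PsiSigma t₁ t₂ t₃ x).1 - 1)
        + Qinfty t₁ t₂ t₃ (PsiSigma t₁ t₂ t₃ x) = 0 ↔
      t₁ * t₂ * t₃ * (x.2.2 - 1) ^ 2 * x.1
        + (t₁ - 1) * (t₂ - 1) * (t₃ - 1) * x.2.2 ^ 2 * x.2.1 = 0 := by
  rw [Qzero_add_Qinfty_PsiSigma h₁₂ h₁₃ h₂₃ hq hq', PsiSigma_fst_sub_one hD,
    Qzero_PsiSigma h₁₂ h₁₃ h₂₃ hq hq', Qinfty_PsiSigma h₁₂ h₁₃ h₂₃ hq hq']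
  have hfst : Dqp t₁ t₂ t₃ x / (x.2.2 - 1) * (PsiSigma t₁ t₂ t₃ x).1 = t₁ * t₂ * t₃ * x.1 := by
    simp only [PsiSigma]
    field_simp
  have hsnd : Dqp t₁ t₂ t₃ x / x.2.2 *
      ((t₁ - 1) * (t₂ - 1) * (t₃ - 1) * x.2.2 * x.2.1 / Dqp t₁ t₂ t₃ x) =
      (t₁ - 1) * (t₂ - 1) * (t₃ - 1) * x.2.1 := by
    field_simp
  rw [hfst, hsnd, ← sub_eq_add_neg, sub_eq_zero, eq_div_iff (mul_ne_zero hq hq'), ← sub_eq_zero]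
  refine Eq.congr_left ?_
  rw [Dqp]
  ring

/-- Lemma 4.1 of the paper: `Ψ_Σ` is a well-defined bijection from
`{Q^Darb ≠ 0}` onto `{c₁+c₂+c₃ = 0, Q₀Q₁Q_∞ ≠ 0}` with the stated inverse,
mapping the Darboux reducible locus onto the reducible locus `Σ^red`. -/
theorem psiSigma_bijection
    (t₁ t₂ t₃ : ℂ)
    (ht₁0 : t₁ ≠ 0) (ht₂0 : t₂ ≠ 0) (ht₃0 : t₃ ≠ 0)
    (ht₁1 : t₁ ≠ 1) (ht₂1 : t₂ ≠ 1) (ht₃1 : t₃ ≠ 1)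
    (h₁₂ : t₁ ≠ t₂) (h₁₃ : t₁ ≠ t₃) (h₂₃ : t₂ ≠ t₃)
    (dom : Set (ℂ × ℂ × ℂ)) (target : Set (ℂ × ℂ × ℂ × ℂ))
    (domRed : Set (ℂ × ℂ × ℂ)) (targetRed : Set (ℂ × ℂ × ℂ × ℂ))
    (hdom : dom = {x | x.2.2 * (x.2.2 - 1) * Dqp t₁ t₂ t₃ x ≠ 0})
    (htarget : target = {y | y.2.1 + y.2.2.1 + y.2.2.2 = 0 ∧
      Qzero t₁ t₂ t₃ y * (Qzero t₁ t₂ t₃ y + Qinfty t₁ t₂ t₃ y)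
        * Qinfty t₁ t₂ t₃ y ≠ 0})
    (hdomRed : domRed = dom ∩ {x |
      t₁ * t₂ * t₃ * (x.2.2 - 1) ^ 2 * x.1
        + (t₁ - 1) * (t₂ - 1) * (t₃ - 1) * x.2.2 ^ 2 * x.2.1 = 0})
    (htargetRed : targetRed = target ∩ {y |
      Qzero t₁ t₂ t₃ y * y.1
        + (Qzero t₁ t₂ t₃ y + Qinfty t₁ t₂ t₃ y) * (y.1 - 1)
        + Qinfty t₁ t₂ t₃ y = 0}) :
    Set.MapsTo (PsiSigma t₁ t₂ t₃) dom target ∧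
    Set.BijOn (PsiSigma t₁ t₂ t₃) dom target ∧
    Set.InvOn (PsiSigmaInv t₁ t₂ t₃) (PsiSigma t₁ t₂ t₃) dom target ∧
    Set.BijOn (PsiSigma t₁ t₂ t₃) domRed targetRed := by
  have hΨ : ∀ x ∈ dom, x.2.2 ≠ 0 ∧ x.2.2 - 1 ≠ 0 ∧ Dqp t₁ t₂ t₃ x ≠ 0 := fun x hx ↦ by
    simpa [hdom, and_assoc] using hx
  have hy : ∀ y ∈ target, y.2.1 + y.2.2.1 + y.2.2.2 = 0 ∧ Qzero t₁ t₂ t₃ y ≠ 0 ∧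
      Qzero t₁ t₂ t₃ y + Qinfty t₁ t₂ t₃ y ≠ 0 ∧ Qinfty t₁ t₂ t₃ y ≠ 0 := fun y hy ↦ by
    simpa [htarget, and_assoc] using hy
  have hmaps : Set.MapsTo (PsiSigma t₁ t₂ t₃) dom target := by
    intro x hx
    obtain ⟨hq, hq', hD⟩ := hΨ x hx
    rw [htarget]
    refine ⟨sum_PsiSigma_eq_zero h₁₂ h₁₃ h₂₃ hq hq', ?_⟩
    rw [Qzero_add_Qinfty_PsiSigma h₁₂ h₁₃ h₂₃ hq hq', Qzero_PsiSigma h₁₂ h₁₃ h₂₃ hq hq',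
      Qinfty_PsiSigma h₁₂ h₁₃ h₂₃ hq hq']
    exact mul_ne_zero (mul_ne_zero (div_ne_zero hD hq') (div_ne_zero hD hq))
      (neg_ne_zero.2 (div_ne_zero hD (mul_ne_zero hq hq')))
  have hmapsInv : Set.MapsTo (PsiSigmaInv t₁ t₂ t₃) target dom := by
    intro y hyt
    obtain ⟨-, h0, h1, hi⟩ := hy y hyt
    rw [hdom, Set.mem_ofPred_eq, PsiSigmaInv_snd_snd_sub_one hi,
      Dqp_PsiSigmaInv ht₁0 ht₂0 ht₃0 ht₁1 ht₂1 ht₃1 hi]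
    exact mul_ne_zero (mul_ne_zero (div_ne_zero (neg_ne_zero.2 h0) hi)
      (div_ne_zero (neg_ne_zero.2 h1) hi))
      (div_ne_zero (neg_ne_zero.2 (mul_ne_zero h0 h1)) hi)
  have hinv : Set.InvOn (PsiSigmaInv t₁ t₂ t₃) (PsiSigma t₁ t₂ t₃) dom target := by
    refine ⟨fun x hx ↦ ?_, fun y hyt ↦ ?_⟩
    · obtain ⟨hq, hq', hD⟩ := hΨ x hx
      exact PsiSigmaInv_PsiSigma ht₁0 ht₂0 ht₃0 ht₁1 ht₂1 ht₃1 h₁₂ h₁₃ h₂₃ hq hq' hD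
    · obtain ⟨hc, h0, h1, hi⟩ := hy y hyt
      exact PsiSigma_PsiSigmaInv ht₁0 ht₂0 ht₃0 ht₁1 ht₂1 ht₃1 h₁₂ h₁₃ h₂₃ hc h0 h1 hi
  have hbij := hinv.bijOn hmaps hmapsInv
  refine ⟨hmaps, hbij, hinv, ?_⟩
  have hred : domRed = dom ∩ PsiSigma t₁ t₂ t₃ ⁻¹' targetRed := by
    ext x
    rw [hdomRed, htargetRed]
    refine and_congr_right fun hx ↦ ?_
    obtain ⟨hq, hq', hD⟩ := hΨ x hx
    exact (PsiSigma_reducible_iff h₁₂ h₁₃ h₂₃ hq hq' hD).symm.trans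
      (and_iff_right (hmaps hx)).symm
  have hsub : targetRed ⊆ target := htargetRed ▸ Set.inter_subset_left
  rw [hred]
  refine ⟨fun x hx ↦ hx.2, hbij.injOn.mono Set.inter_subset_left, fun y hyr ↦ ?_⟩
  obtain ⟨x, hx, rfl⟩ := hbij.surjOn (hsub hyr)
  exact ⟨x, ⟨hx, hyr⟩, rfl⟩
end

section
/- Let T ⊂ ℂ³ be the open set of triples (t₁,t₂,t₃) of pairwise distinct points of ℂ \ {0,1}. Define, on the open subset of T × ℂ⁶ (coordinates (t,q,p)) where q₁, q₂, q₃ are pairwise distinct and Λ ≠ 0 — with Λ := Σ_{{i,j,k}={1,2,3}} p_i(q_i−t₁)(q_i−t₂)(q_i−t₃)/((q_i−q_j)(q_i−q_k)) and Λ_ℓ := Λ with t_ℓ replaced by 1 — the holomorphic map Ψ̂(t,q,p) := (t, z₁,z₂,z₃, c₁,c₂,c₃), where zᵢ := tᵢΛᵢ/Λ and cᵢ := −((q₁−tᵢ)(q₂−tᵢ)(q₃−tᵢ)/(tᵢ(tᵢ−1)(tᵢ−t_j)(tᵢ−t_k)))·Λ. Then every point (t,q,p) with q₁ = 0, q₂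 = 1, p₃ = 0 and q₃(q₃−1)·(t₁t₂t₃(q₃−1)p₁ − (t₁−1)(t₂−1)(t₃−1)q₃p₂) ≠ 0 lies in the domain of Ψ̂, and has an open neighborhood in T × ℂ⁶ that Ψ̂ maps biholomorphically onto an open subset of T × ℂ⁶. -/
/-- The Darboux coordinate change `(t,q,p) ↦ (t,z,c)`, extended by the
identity in the `t` variables. -/
noncomputable def PsiHat (x : (Fin 3 → ℂ) × (Fin 3 → ℂ) × (Fin 3 → ℂ)) :
    (Fin 3 → ℂ) × (Fin 3 → ℂ) × (Fin 3 → ℂ) :=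
  (x.1,
   fun i => x.1 i * Lam (Function.update x.1 i 1) x.2.1 x.2.2 / Lam x.1 x.2.1 x.2.2,
   fun i => -((x.2.1 0 - x.1 i) * (x.2.1 1 - x.1 i) * (x.2.1 2 - x.1 i)
        / (x.1 i * (x.1 i - 1) * (x.1 i - x.1 (i + 1)) * (x.1 i - x.1 (i + 2))))
      * Lam x.1 x.2.1 x.2.2)

/-- The linearization of the Darboux coordinate change at a point of `Σ^Darb`, in the variables
`q_j` and `p_j / ∏ k ≠ j, (q_j - q_k)`, has trivial kernel. -/
theorem eq_zero_of_linearized_eqs {t₀ t₁ t₂ y a b u v w a' b' c' L δ : ℂ}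
    (h1 : t₁ ≠ 0) (h2 : t₂ ≠ 0)
    (k0 : t₀ ≠ 1) (k1 : t₁ ≠ 1) (k2 : t₂ ≠ 1)
    (h01 : t₀ ≠ t₁) (h02 : t₀ ≠ t₂) (h12 : t₁ ≠ t₂) (hy0 : y ≠ 0) (hy1 : y ≠ 1)
    (hL : L = -(a * (t₀ * t₁ * t₂)) + b * ((1 - t₀) * (1 - t₁) * (1 - t₂))) (hL0 : L ≠ 0)
    (hδ : δ = -(a' * (t₀ * t₁ * t₂)) + a * u * (t₀ * t₁ + t₀ * t₂ + t₁ * t₂)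
      + b' * ((1 - t₀) * (1 - t₁) * (1 - t₂))
      + b * v * ((1 - t₀) * (1 - t₁) + (1 - t₀) * (1 - t₂) + (1 - t₁) * (1 - t₂))
      + c' * ((y - t₀) * (y - t₁) * (y - t₂)))
    (hc₀ : (u * ((1 - t₀) * (y - t₀)) - t₀ * v * (y - t₀) - t₀ * (1 - t₀) * w) * L
      - t₀ * (1 - t₀) * (y - t₀) * δ = 0)
    (hc₁ : (u * ((1 - t₁) * (y - t₁)) - t₁ * v * (y - t₁) - t₁ * (1 - t₁) * w) * L
      - t₁ * (1 - t₁) * (y - t₁) * δ = 0)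
    (hc₂ : (u * ((1 - t₂) * (y - t₂)) - t₂ * v * (y - t₂) - t₂ * (1 - t₂) * w) * L
      - t₂ * (1 - t₂) * (y - t₂) * δ = 0)
    (hz₀ : (-(a' * (t₁ * t₂)) + a * u * (t₁ * t₂ + t₁ + t₂) + b * v * ((1 - t₁) * (1 - t₂))
      + c' * ((y - 1) * (y - t₁) * (y - t₂))) * L = -(a * (t₁ * t₂)) * δ)
    (hz₁ : (-(a' * (t₀ * t₂)) + a * u * (t₀ * t₂ + t₀ + t₂) + b * v * ((1 - t₀) * (1 - t₂))
      + c' * ((y - 1) * (y - t₀) * (y - t₂))) * L = -(a * (t₀ * t₂)) * δ)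
    (hz₂ : (-(a' * (t₀ * t₁)) + a * u * (t₀ * t₁ + t₀ + t₁) + b * v * ((1 - t₀) * (1 - t₁))
      + c' * ((y - 1) * (y - t₀) * (y - t₁))) * L = -(a * (t₀ * t₁)) * δ) :
    u = 0 ∧ v = 0 ∧ w = 0 ∧ a' = 0 ∧ b' = 0 ∧ c' = 0 := by
  have d01 := sub_ne_zero.2 h01
  have d02 := sub_ne_zero.2 h02
  have d12 := sub_ne_zero.2 h12
  have hy1' := sub_ne_zero.2 hy1
  have hV : (t₀ - t₁) * (t₀ - t₂) * (t₁ - t₂) ≠ 0 := by simp [d01, d02, d12]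
  have interp : ∀ X : ℂ, (u * ((1 - X) * (y - X)) - X * v * (y - X) - X * (1 - X) * w) * L
      - X * (1 - X) * (y - X) * δ = δ * ((t₀ - X) * (t₁ - X) * (t₂ - X)) := by
    intro X
    apply mul_left_cancel₀ hV
    linear_combination (t₁ - t₂) * (X - t₁) * (X - t₂) * hc₀
      - (t₀ - t₂) * (X - t₀) * (X - t₂) * hc₁ + (t₀ - t₁) * (X - t₀) * (X - t₁) * hc₂
  have hu := interp 0
  have hv := interp 1
  have hw := interp y
  have l2 : a * u * t₂ + b * v * (1 - t₂) + c' * ((y - 1) * y * (y - t₂)) = 0 := by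
    apply mul_left_cancel₀ (mul_ne_zero d01 hL0)
    linear_combination t₀ * hz₀ - t₁ * hz₁
  have l1 : a * u * t₁ + b * v * (1 - t₁) + c' * ((y - 1) * y * (y - t₁)) = 0 := by
    apply mul_left_cancel₀ (mul_ne_zero d02 hL0)
    linear_combination t₀ * hz₀ - t₂ * hz₂
  have slope : a * u - b * v - c' * ((y - 1) * y) = 0 := by
    apply mul_left_cancel₀ d12
    linear_combination l1 - l2
  have const : b * v + c' * ((y - 1) * y * y) = 0 := by
    linear_combination l1 - t₁ * slope
  have hδ0 : δ = 0 := by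
    apply mul_left_cancel₀ (mul_ne_zero hL0 hL0)
    linear_combination (-L * L * y) * slope - L * L * const + L * a * hu
      + L * b * hv + L * δ * hL
  subst hδ0
  have u0 : u = 0 := by
    apply mul_left_cancel₀ (mul_ne_zero hL0 hy0)
    linear_combination hu
  have v0 : v = 0 := by
    apply mul_left_cancel₀ (mul_ne_zero hL0 hy1')
    linear_combination -hv
  have w0 : w = 0 := by
    apply mul_left_cancel₀ (mul_ne_zero hL0 (mul_ne_zero hy0 hy1'))
    linear_combination hw
  subst u0 v0 w0
  have c0 : c' = 0 := by
    apply mul_left_cancel₀ (mul_ne_zero hy1' hy0)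
    linear_combination -slope
  subst c0
  have a0 : a' = 0 := by
    apply mul_left_cancel₀ (mul_ne_zero (mul_ne_zero h1 h2) hL0)
    linear_combination -hz₀
  subst a0
  refine ⟨rfl, rfl, rfl, rfl, ?_, rfl⟩
  apply mul_left_cancel₀ (mul_ne_zero (mul_ne_zero (sub_ne_zero.2 k0.symm) (sub_ne_zero.2 k1.symm))
    (sub_ne_zero.2 k2.symm))
  linear_combination -hδ

theorem hasDerivAt_lagrange_sum {q₀ q₁ q₂ a₀ a₁ a₂ : ℂ → ℂ} {u v w a₀' a₁' a₂' s : ℂ}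
    (hq₀ : HasDerivAt q₀ u s) (hq₁ : HasDerivAt q₁ v s) (hq₂ : HasDerivAt q₂ w s)
    (ha₀ : HasDerivAt a₀ a₀' s) (ha₁ : HasDerivAt a₁ a₁' s) (ha₂ : HasDerivAt a₂ a₂' s)
    (α β γ : ℂ) :
    HasDerivAt
      (fun s => a₀ s * ((q₀ s - α) * (q₀ s - β) * (q₀ s - γ))
        + a₁ s * ((q₁ s - α) * (q₁ s - β) * (q₁ s - γ))
        + a₂ s * ((q₂ s - α) * (q₂ s - β) * (q₂ s - γ)))
      (a₀' * ((q₀ s - α) * (q₀ s - β) * (q₀ s - γ))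
        + a₀ s * ((u * (q₀ s - β) + (q₀ s - α) * u) * (q₀ s - γ)
          + (q₀ s - α) * (q₀ s - β) * u)
        + (a₁' * ((q₁ s - α) * (q₁ s - β) * (q₁ s - γ))
        + a₁ s * ((v * (q₁ s - β) + (q₁ s - α) * v) * (q₁ s - γ)
          + (q₁ s - α) * (q₁ s - β) * v))
        + (a₂' * ((q₂ s - α) * (q₂ s - β) * (q₂ s - γ))
        + a₂ s * ((w * (q₂ s - β) + (q₂ s - α) * w) * (q₂ s - γ)
          + (q₂ s - α) * (q₂ s - β) * w))) s := by
  have cubic {q : ℂ → ℂ} {d : ℂ} (hq : HasDerivAt q d s) :=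
    ((hq.sub_const α).fun_mul (hq.sub_const β)).fun_mul (hq.sub_const γ)
  exact ((ha₀.fun_mul (cubic hq₀)).fun_add (ha₁.fun_mul (cubic hq₁))).fun_add
    (ha₂.fun_mul (cubic hq₂))

/-- The holomorphic inverse function theorem in finite dimension, stated with an injective
derivative. -/
theorem ContDiffAt.exists_local_biholomorphism {E : Type*} [NormedAddCommGroup E]
    [NormedSpace ℂ E] [FiniteDimensional ℂ E] {f : E → E} {x : E} (hf : ContDiffAt ℂ 1 f x)
    (hker : ∀ v, fderiv ℂ f x v = 0 → v = 0) :
    ∃ (V : Set E) (g : E → E), IsOpen V ∧ x ∈ V ∧ IsOpen (f '' V) ∧ DifferentiableOn ℂ f V ∧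
      Set.InvOn g f V (f '' V) ∧ DifferentiableOn ℂ g (f '' V) := by
  have : CompleteSpace E := FiniteDimensional.complete ℂ E
  let L : E ≃L[ℂ] E := (LinearEquiv.ofInjectiveEndo (fderiv ℂ f x : E →ₗ[ℂ] E)
    ((injective_iff_map_eq_zero _).2 hker)).toContinuousLinearEquiv
  have hL : HasFDerivAt f (L : E →L[ℂ] E) x := (hf.differentiableAt one_ne_zero).hasFDerivAt
  let e := hf.toOpenPartialHomeomorph f hL one_ne_zero
  have hxe : x ∈ e.source := hf.mem_toOpenPartialHomeomorph_source hL one_ne_zero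
  have hsymm : ContDiffAt ℂ 1 e.symm (e x) := hf.to_localInverse hL one_ne_zero
  have h1 : ∀ᶠ y in nhds x, DifferentiableAt ℂ f y :=
    (hf.eventually (by simp)).mono fun y hy => hy.differentiableAt one_ne_zero
  have h2 : ∀ᶠ y in nhds x, DifferentiableAt ℂ e.symm (e y) :=
    (e.continuousAt hxe).eventually
      ((hsymm.eventually (by simp)).mono fun y hy => hy.differentiableAt one_ne_zero)
  obtain ⟨V, hV, hVo, hxV⟩ :=
    eventually_nhds_iff.1 ((h1.and h2).and (e.open_source.mem_nhds hxe))
  refine ⟨V, e.symm, hVo, hxV,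
    e.isOpen_image_of_subset_source hVo fun y hy => (hV y hy).2,
    fun y hy => (hV y hy).1.1.differentiableWithinAt, ⟨fun y hy => e.left_inv (hV y hy).2, ?_⟩, ?_⟩
  · rintro _ ⟨y, hy, rfl⟩
    exact congrArg f (e.left_inv (hV y hy).2)
  · rintro _ ⟨y, hy, rfl⟩
    exact (hV y hy).1.2.differentiableWithinAt

theorem Lam_eq (t q p : Fin 3 → ℂ) :
    Lam t q p = p 0 / ((q 0 - q 1) * (q 0 - q 2)) * ((q 0 - t 0) * (q 0 - t 1) * (q 0 - t 2))
      + p 1 / ((q 1 - q 0) * (q 1 - q 2)) * ((q 1 - t 0) * (q 1 - t 1) * (q 1 - t 2))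
      + p 2 / ((q 2 - q 0) * (q 2 - q 1)) * ((q 2 - t 0) * (q 2 - t 1) * (q 2 - t 2)) := by
  simp only [Lam, div_mul_eq_mul_div]

theorem Lam_eq_of_zero_one_zero {t q p : Fin 3 → ℂ} (hq₁ : q 0 = 0) (hq₂ : q 1 = 1) (hp₃ : p 2 = 0) :
    Lam t q p = -(p 0 / q 2 * (t 0 * t 1 * t 2))
      + p 1 / (1 - q 2) * ((1 - t 0) * (1 - t 1) * (1 - t 2)) := by
  simp only [Lam_eq, hq₁, hq₂, hp₃, zero_div]
  ring

theorem contDiffAt_PsiHat {x : (Fin 3 → ℂ) × (Fin 3 → ℂ) × (Fin 3 → ℂ)}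
    (ht0 : ∀ i, x.1 i ≠ 0) (ht1 : ∀ i, x.1 i ≠ 1) (htinj : Function.Injective x.1)
    (hq : Function.Injective x.2.1) (hLam : Lam x.1 x.2.1 x.2.2 ≠ 0) :
    ContDiffAt ℂ 1 PsiHat x := by
  have hq' : ∀ i j, i ≠ j → x.2.1 i - x.2.1 j ≠ 0 := fun i j h => sub_ne_zero.2 (hq.ne h)
  have ht' : ∀ i j, i ≠ j → x.1 i - x.1 j ≠ 0 := fun i j h => sub_ne_zero.2 (htinj.ne h)
  have hcomp : ∀ t : (Fin 3 → ℂ) × (Fin 3 → ℂ) × (Fin 3 → ℂ) → Fin 3 → ℂ,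
      ContDiffAt ℂ 1 t x → ContDiffAt ℂ 1 (fun y => Lam (t y) y.2.1 y.2.2) x := by
    intro t ht
    have h01 := mul_ne_zero (hq' 0 1 (by decide)) (hq' 0 2 (by decide))
    have h10 := mul_ne_zero (hq' 1 0 (by decide)) (hq' 1 2 (by decide))
    have h20 := mul_ne_zero (hq' 2 0 (by decide)) (hq' 2 1 (by decide))
    unfold Lam
    fun_prop (disch := assumption)
  have hfst : ContDiffAt ℂ 1 (fun y : (Fin 3 → ℂ) × (Fin 3 → ℂ) × (Fin 3 → ℂ) => y.1) x := by
    fun_prop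
  have hupd (i : Fin 3) : ContDiffAt ℂ 1
      (fun y : (Fin 3 → ℂ) × (Fin 3 → ℂ) × (Fin 3 → ℂ) => Function.update y.1 i (1 : ℂ)) x := by
    refine contDiffAt_pi.2 fun j => ?_
    rcases eq_or_ne j i with rfl | h
    · simpa using contDiffAt_const
    · simp only [Function.update_of_ne h]
      fun_prop
  have hL := hcomp _ hfst
  refine hfst.prodMk (ContDiffAt.prodMk (contDiffAt_pi.2 fun i => ?_) (contDiffAt_pi.2 fun i => ?_))
  · have hLi := hcomp _ (hupd i)
    fun_prop (disch := assumption)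
  · have hd : x.1 i * (x.1 i - 1) * (x.1 i - x.1 (i + 1)) * (x.1 i - x.1 (i + 2)) ≠ 0 :=
      mul_ne_zero (mul_ne_zero (mul_ne_zero (ht0 i) (sub_ne_zero.2 (ht1 i)))
        (ht' _ _ (by fin_cases i <;> decide))) (ht' _ _ (by fin_cases i <;> decide))
    fun_prop (disch := assumption)

theorem eq_zero_of_fderiv_PsiHat_eq_zero {x : (Fin 3 → ℂ) × (Fin 3 → ℂ) × (Fin 3 → ℂ)}
    (ht0 : ∀ i, x.1 i ≠ 0) (ht1 : ∀ i, x.1 i ≠ 1) (htinj : Function.Injective x.1)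
    (hq₁ : x.2.1 0 = 0) (hq₂ : x.2.1 1 = 1) (hp₃ : x.2.2 2 = 0)
    (hq : Function.Injective x.2.1) (hLam : Lam x.1 x.2.1 x.2.2 ≠ 0)
    {v : (Fin 3 → ℂ) × (Fin 3 → ℂ) × (Fin 3 → ℂ)} (hv : fderiv ℂ PsiHat x v = 0) : v = 0 := by
  have hdiff := (contDiffAt_PsiHat ht0 ht1 htinj hq hLam).differentiableAt one_ne_zero
  have hline : HasDerivAt (fun s : ℂ => x + s • v) v 0 := by
    simpa using ((hasDerivAt_id (0 : ℂ)).smul_const v).const_add x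
  have hΨ : HasDerivAt (fun s : ℂ => PsiHat (x + s • v)) 0 0 := by
    have h := hdiff.hasFDerivAt
    rw [← hv]
    exact HasFDerivAt.comp_hasDerivAt_of_eq (0 : ℂ) h hline (by simp)
  obtain ⟨t, q, p⟩ := x
  obtain ⟨t', q', p'⟩ := v
  dsimp only at *
  have ht' : t' = 0 := by
    have h1 : HasDerivAt (fun s : ℂ => t + s • t') 0 0 := hΨ.fst
    have h2 : HasDerivAt (fun s : ℂ => t + s • t') t' 0 := hline.fst
    exact h2.unique h1
  subst ht'
  have hqd (i : Fin 3) : HasDerivAt (fun s : ℂ => q i + s * q' i) (q' i) 0 :=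
    hasDerivAt_pi.1 hline.snd.fst i
  have hpd (i : Fin 3) : HasDerivAt (fun s : ℂ => p i + s * p' i) (p' i) 0 :=
    hasDerivAt_pi.1 hline.snd.snd i
  have hne (i j : Fin 3) (h : i ≠ j) : q i - q j ≠ 0 := sub_ne_zero.2 (hq.ne h)
  have had (i j k : Fin 3) (hj : i ≠ j) (hk : i ≠ k) : ∃ d, HasDerivAt
      (fun s : ℂ => (p i + s * p' i) / ((q i + s * q' i - (q j + s * q' j))
        * (q i + s * q' i - (q k + s * q' k)))) d 0 ∧ (q' = 0 → d = 0 → p' i = 0) := by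
    have hD := ((hqd i).fun_sub (hqd j)).fun_mul ((hqd i).fun_sub (hqd k))
    have h := (hpd i).fun_div hD (by simpa using ⟨hne i j hj, hne i k hk⟩)
    refine ⟨_, h, fun h0 h1 => ?_⟩
    simpa [h0, hne i j hj, hne i k hk] using h1
  obtain ⟨a, ha, ha0⟩ := had 0 1 2 (by decide) (by decide)
  obtain ⟨b, hb, hb0⟩ := had 1 0 2 (by decide) (by decide)
  obtain ⟨c, hc, hc0⟩ := had 2 0 1 (by decide) (by decide)
  have hsum := hasDerivAt_lagrange_sum (hqd 0) (hqd 1) (hqd 2) ha hb hc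
  have hz (i : Fin 3) : HasDerivAt (fun s : ℂ => t i * Lam (Function.update t i 1)
      (q + s • q') (p + s • p') / Lam t (q + s • q') (p + s • p')) 0 0 := by
    simpa [PsiHat] using hasDerivAt_pi.1 hΨ.snd.fst i
  have hcc (i : Fin 3) : HasDerivAt (fun s : ℂ => -((q 0 + s * q' 0 - t i) * (q 1 + s * q' 1 - t i)
      * (q 2 + s * q' 2 - t i) / (t i * (t i - 1) * (t i - t (i + 1)) * (t i - t (i + 2))))
      * Lam t (q + s • q') (p + s • p')) 0 0 := by
    simpa [PsiHat] using hasDerivAt_pi.1 hΨ.snd.snd i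
  have hLd (τ : Fin 3 → ℂ) : HasDerivAt (fun s : ℂ => Lam τ (q + s • q') (p + s • p'))
      (-(a * (τ 0 * τ 1 * τ 2)) + p 0 / q 2 * q' 0 * (τ 0 * τ 1 + τ 0 * τ 2 + τ 1 * τ 2)
        + b * ((1 - τ 0) * (1 - τ 1) * (1 - τ 2))
        + p 1 / (1 - q 2) * q' 1 * ((1 - τ 0) * (1 - τ 1) + (1 - τ 0) * (1 - τ 2)
          + (1 - τ 1) * (1 - τ 2))
        + c * ((q 2 - τ 0) * (q 2 - τ 1) * (q 2 - τ 2))) 0 := by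
    simp only [Lam_eq]
    refine (hsum (τ 0) (τ 1) (τ 2)).congr_deriv ?_
    simp only [hq₁, hq₂, hp₃, zero_mul, add_zero, zero_div]
    ring
  have hδ := hLd t
  generalize hδe : -(a * (t 0 * t 1 * t 2)) + _ + _ + _ + _ = δ at hδ
  have hzi (i : Fin 3) (d : ℂ) (hd : HasDerivAt
      (fun s : ℂ => Lam (Function.update t i 1) (q + s • q') (p + s • p')) d 0) :
      d * Lam t q p = Lam (Function.update t i 1) q p * δ := by
    have h := ((hd.const_mul (t i)).fun_div hδ (by simpa using hLam)).unique (hz i)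
    simp only [zero_smul, add_zero, div_eq_zero_iff, pow_eq_zero_iff, hLam, ne_eq,
      OfNat.ofNat_ne_zero, not_false_eq_true, or_false] at h
    apply mul_left_cancel₀ (ht0 i)
    linear_combination h
  have hci (i : Fin 3) : (q' 0 * ((1 - t i) * (q 2 - t i)) - t i * q' 1 * (q 2 - t i)
      - t i * (1 - t i) * q' 2) * Lam t q p - t i * (1 - t i) * (q 2 - t i) * δ = 0 := by
    have hd : t i * (t i - 1) * (t i - t (i + 1)) * (t i - t (i + 2)) ≠ 0 :=
      mul_ne_zero (mul_ne_zero (mul_ne_zero (ht0 i) (sub_ne_zero.2 (ht1 i)))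
        (sub_ne_zero.2 (htinj.ne (by fin_cases i <;> decide))))
        (sub_ne_zero.2 (htinj.ne (by fin_cases i <;> decide)))
    have h := ((((((hqd 0).sub_const (t i)).fun_mul ((hqd 1).sub_const (t i))).fun_mul
      ((hqd 2).sub_const (t i))).div_const _).fun_neg.fun_mul hδ).unique (hcc i)
    simp only [hq₁, hq₂, zero_smul, add_zero, zero_mul] at h
    generalize t i * (t i - 1) * (t i - t (i + 1)) * (t i - t (i + 2)) = D at hd h
    field_simp at h
    linear_combination -h
  have hz₀ := hzi 0 _ (hLd _)
  have hz₁ := hzi 1 _ (hLd _)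
  have hz₂ := hzi 2 _ (hLd _)
  rw [Lam_eq_of_zero_one_zero (t := Function.update t _ 1) hq₁ hq₂ hp₃] at hz₀ hz₁ hz₂
  simp only [Fin.isValue, Function.update_self, ne_eq, one_ne_zero, not_false_eq_true,
    Function.update_of_ne, one_mul, Fin.reduceEq, sub_self, zero_mul, mul_zero, add_zero, zero_add,
    neg_mul, zero_ne_one, mul_one] at hz₀ hz₁ hz₂
  obtain ⟨hu, hv, hw, ha', hb', hc'⟩ := eq_zero_of_linearized_eqs (y := q 2)
    (a := p 0 / q 2) (b := p 1 / (1 - q 2)) (a' := a) (b' := b) (c' := c) (ht0 1) (ht0 2)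
    (ht1 0) (ht1 1) (ht1 2) (htinj.ne (by decide)) (htinj.ne (by decide)) (htinj.ne (by decide))
    (fun h => hq.ne (show (2 : Fin 3) ≠ 0 by decide) (h.trans hq₁.symm))
    (fun h => hq.ne (show (2 : Fin 3) ≠ 1 by decide) (h.trans hq₂.symm))
    (Lam_eq_of_zero_one_zero hq₁ hq₂ hp₃) hLam hδe.symm (hci 0) (hci 1) (hci 2)
    (by linear_combination hz₀) (by linear_combination hz₁) (by linear_combination hz₂)
  have hq' : q' = 0 := by ext i; fin_cases i <;> assumption
  have hp' : p' = 0 := by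
    ext i
    fin_cases i
    exacts [ha0 hq' ha', hb0 hq' hb', hc0 hq' hc']
  simp [hq', hp']

/-- Lemma 4.2 of the paper: every point of `Σ^Darb \ {Q^Darb = 0}` lies in
the domain of the Darboux coordinate change `Ψ̂` (i.e. the `q`'s are pairwise
distinct and `Λ ≠ 0` there), and has an open neighborhood which `Ψ̂` maps
biholomorphically onto an open subset of `T × ℂ⁶`. -/
theorem psiHat_local_biholomorphism
    (x : (Fin 3 → ℂ) × (Fin 3 → ℂ) × (Fin 3 → ℂ))
    (ht0 : ∀ i, x.1 i ≠ 0) (ht1 : ∀ i, x.1 i ≠ 1)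
    (htinj : Function.Injective x.1)
    (hq₁ : x.2.1 0 = 0) (hq₂ : x.2.1 1 = 1) (hp₃ : x.2.2 2 = 0)
    (hQ : x.2.1 2 * (x.2.1 2 - 1) *
        (x.1 0 * x.1 1 * x.1 2 * (x.2.1 2 - 1) * x.2.2 0
          - (x.1 0 - 1) * (x.1 1 - 1) * (x.1 2 - 1) * x.2.1 2 * x.2.2 1) ≠ 0) :
    (Function.Injective x.2.1 ∧ Lam x.1 x.2.1 x.2.2 ≠ 0) ∧
    ∃ (V : Set ((Fin 3 → ℂ) × (Fin 3 → ℂ) × (Fin 3 → ℂ)))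
      (g : (Fin 3 → ℂ) × (Fin 3 → ℂ) × (Fin 3 → ℂ) →
           (Fin 3 → ℂ) × (Fin 3 → ℂ) × (Fin 3 → ℂ)),
      IsOpen V ∧ x ∈ V ∧ IsOpen (PsiHat '' V) ∧
      DifferentiableOn ℂ PsiHat V ∧
      Set.InvOn g PsiHat V (PsiHat '' V) ∧
      DifferentiableOn ℂ g (PsiHat '' V) := by

  have hy : x.2.1 2 ≠ 0 := by rintro h; simp [h] at hQ
  have hy1 : x.2.1 2 ≠ 1 := by rintro h; simp [h] at hQ
  have hq : Function.Injective x.2.1 := by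
    intro i j
    fin_cases i <;> fin_cases j <;> simp [hq₁, hq₂, hy, hy1, hy.symm, hy1.symm]
  have hLam : Lam x.1 x.2.1 x.2.2 ≠ 0 := by
    intro h
    apply hQ
    have hy1' : (1 : ℂ) - x.2.1 2 ≠ 0 := sub_ne_zero.2 hy1.symm
    rw [Lam_eq_of_zero_one_zero hq₁ hq₂ hp₃] at h
    field_simp at h
    linear_combination x.2.1 2 * (x.2.1 2 - 1) * h
  exact ⟨⟨hq, hLam⟩, (contDiffAt_PsiHat ht0 ht1 htinj hq hLam).exists_local_biholomorphism
    fun v => eq_zero_of_fderiv_PsiHat_eq_zero ht0 ht1 htinj hq₁ hq₂ hp₃ hq hLam⟩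
end
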